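/- arXiv:math/0603670 — 2 statements merged into one kernel-verified Lean document; each statement's English description precedes it below -/
import Mathlib

section
/- Let (W,S) be an irreducible Coxeter system of finite rank. If W contains an infinite cyclic subgroup ⟨x⟩ of finite index, then W is isomorphic to the infinite dihedral group D_∞. -/
namespace CoxeterPaper

/-- The Coxeter graph: vertices are the elements of `B`, and `i ≠ j` are adjacent
iff `m i j ≥ 3` (including `m i j = ∞`, encoded as `0`), i.e. iff `m i j ≠ 2`. -/
def coxeterGraph {B : Type*} (M : CoxeterMatrix B) : SimpleGraph B :=
  SimpleGraph.fromRel fun i j => M i j ≠ 2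

/-- A Coxeter matrix (system) is irreducible if its Coxeter graph is connected. -/
def IsIrreducible {B : Type*} (M : CoxeterMatrix B) : Prop := (coxeterGraph M).Connected

/-- The Coxeter matrix of the infinite dihedral group `D_∞`: two generators
`s₁, s₂` with `m_{s₁ s₂} = ∞` (encoded as `0`). -/
def DInftyMatrix : CoxeterMatrix (Fin 2) where
  M := Matrix.of fun i j => if i = j then 1 else 0
  isSymm := by unfold Matrix.IsSymm; aesop
  diagonal := by simp
  off_diagonal := by simp

/-- The infinite dihedral group `D_∞`, as the Coxeter group on two generators
`s₁, s₂` with `m_{s₁ s₂} = ∞`. -/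
def DInfty : Type := DInftyMatrix.Group

noncomputable instance : Group DInfty := by unfold DInfty CoxeterMatrix.Group; infer_instance

section VirtuallyCyclic

variable {G : Type*} [Group G]

/-- Every element of `D_∞ = ⟨s₁, s₂⟩` is a power of `s₁ s₂`, or `s₁` times such a power. -/
theorem DInftyMatrix_group_normal_form (d : DInftyMatrix.Group) :
    ∃ k : ℤ, d = (DInftyMatrix.simple 0 * DInftyMatrix.simple 1) ^ k ∨
      d = DInftyMatrix.simple 0 * (DInftyMatrix.simple 0 * DInftyMatrix.simple 1) ^ k := by
  have hsq (i : Fin 2) : DInftyMatrix.simple i * DInftyMatrix.simple i = 1 :=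
    DInftyMatrix.toCoxeterSystem.simple_mul_simple_self i
  set a := DInftyMatrix.simple 0 with ha
  set b := DInftyMatrix.simple 1 with hb
  induction d using DInftyMatrix.toCoxeterSystem.simple_induction_left with
  | one => exact ⟨0, by simp⟩
  | mul_simple_left w i hw =>
    rw [CoxeterMatrix.toCoxeterSystem_simple]
    obtain ⟨k, rfl | rfl⟩ := hw <;> fin_cases i
    · exact ⟨k, Or.inr rfl⟩
    · refine ⟨k + 1, Or.inr ?_⟩
      rw [add_comm, zpow_add, zpow_one, ← mul_assoc, ← mul_assoc, hsq 0, one_mul]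
      rfl
    · refine ⟨k, Or.inl ?_⟩
      change a * (a * _) = _
      rw [← mul_assoc, hsq 0, one_mul]
    · refine ⟨k - 1, Or.inl ?_⟩
      change b * (a * _) = _
      have : (a * b)⁻¹ = b * a := by
        rw [inv_eq_iff_mul_eq_one, mul_assoc, ← mul_assoc b, hsq 1, one_mul, hsq 0]
      rw [← mul_assoc, ← this, sub_eq_add_neg, add_comm, zpow_add, zpow_neg_one]

/-- A group generated by an element `z` of infinite order and an involution `s ∉ ⟨z⟩`
inverting `z` is isomorphic to `D_∞`. -/
theorem nonempty_mulEquiv_DInfty {s z : G} (hs : s * s = 1) (hsz : s * z * s = z⁻¹)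
    (hz : ¬ IsOfFinOrder z) (hmem : s ∉ Subgroup.zpowers z)
    (hcov : ∀ g : G, g ∈ Subgroup.zpowers z ∨ s * g ∈ Subgroup.zpowers z) :
    Nonempty (G ≃* DInfty) := by
  have hlift : DInftyMatrix.IsLiftable ![s, s * z] := by
    have h1 : s * z * (s * z) = 1 := by rw [← mul_assoc, hsz, inv_mul_cancel]
    intro i j
    fin_cases i <;> fin_cases j <;> simp [DInftyMatrix, hs, h1]
  let f : DInftyMatrix.Group →* G := DInftyMatrix.toCoxeterSystem.lift ⟨_, hlift⟩
  have hf0 : f (DInftyMatrix.simple 0) = s := DInftyMatrix.toCoxeterSystem.lift_apply_simple hlift 0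
  have hf1 : f (DInftyMatrix.simple 1) = s * z :=
    DInftyMatrix.toCoxeterSystem.lift_apply_simple hlift 1
  have hf01 : f (DInftyMatrix.simple 0 * DInftyMatrix.simple 1) = z := by
    rw [map_mul, hf0, hf1, ← mul_assoc, hs, one_mul]
  have hinj : Function.Injective f := by
    rw [injective_iff_map_eq_one]
    intro d hd
    obtain ⟨k, rfl | rfl⟩ := DInftyMatrix_group_normal_form d
    · rw [map_zpow, hf01] at hd
      have : k = 0 := injective_zpow_iff_not_isOfFinOrder.2 hz (by simpa using hd)
      simp [this]
    · rw [map_mul, map_zpow, hf01, hf0] at hd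
      exact absurd ⟨-k, by simpa using (eq_inv_of_mul_eq_one_left hd).symm⟩ hmem
  have hsurj : Function.Surjective f := by
    intro g
    obtain ⟨k, hk⟩ | ⟨k, hk⟩ := hcov g
    · exact ⟨(DInftyMatrix.simple 0 * DInftyMatrix.simple 1) ^ k, by
        rw [map_zpow, hf01]; exact hk⟩
    · refine ⟨DInftyMatrix.simple 0 * (DInftyMatrix.simple 0 * DInftyMatrix.simple 1) ^ k, ?_⟩
      rw [map_mul, map_zpow, hf01, hf0]
      change z ^ k = s * g at hk
      rw [hk, ← mul_assoc, hs, one_mul]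
  exact ⟨(MulEquiv.ofBijective f ⟨hinj, hsurj⟩).symm⟩

/-- If the centralizer `C` of a normal infinite cyclic subgroup `H` of finite index has no
nontrivial finite subgroup normal in `G`, then `C` is cyclic. -/
theorem isCyclic_centralizer_of_no_finite_normal
    (hfin : ∀ N : Subgroup G, N.Normal → Finite N → N = ⊥)
    {y : G} (hy : ¬ IsOfFinOrder y) [(Subgroup.zpowers y).Normal]
    [(Subgroup.zpowers y).FiniteIndex] :
    IsCyclic (Subgroup.centralizer (Subgroup.zpowers y : Set G)) ∧
      ∀ c ∈ Subgroup.centralizer (Subgroup.zpowers y : Set G), IsOfFinOrder c → c = 1 := by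
  set H := Subgroup.zpowers y with hH
  set C := Subgroup.centralizer (H : Set G) with hC
  have htor : ∀ h ∈ H, IsOfFinOrder h → h = 1 := by
    rintro _ ⟨k, rfl⟩ hk
    obtain ⟨n, hn, hkn⟩ := isOfFinOrder_iff_pow_eq_one.1 hk
    have h : k * n = 0 := injective_zpow_iff_not_isOfFinOrder.2 hy (by simpa [zpow_mul] using hkn)
    have hk0 : k = 0 := (mul_eq_zero.1 h).resolve_right (by exact_mod_cast hn.ne')
    simp [hk0]
  have hcent : H.subgroupOf C ≤ Subgroup.center C := by
    intro h hh
    rw [Subgroup.mem_center_iff]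
    intro c
    exact Subtype.ext (Subgroup.mem_centralizer_iff.1 c.2 h hh).symm
  have : (Subgroup.center C).FiniteIndex := Subgroup.finiteIndex_of_le hcent
  set m := (Subgroup.center C).index
  set r := H.index
  have hm : m ≠ 0 := Subgroup.FiniteIndex.index_ne_zero
  have hr : r ≠ 0 := Subgroup.FiniteIndex.index_ne_zero
  have hpow (g : G) : g ^ (m * r) ∈ H := by
    rw [pow_mul]; exact H.pow_index_mem _
  let f : C →* H :=
    { toFun c := ⟨(c : G) ^ (m * r), hpow c⟩
      map_one' := by simp
      map_mul' a b := by
        have h : (a * b) ^ (m * r) = a ^ (m * r) * b ^ (m * r) := by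
          have h1 : (a * b) ^ m = a ^ m * b ^ m :=
            congrArg Subtype.val (map_mul (MonoidHom.transferCenterPow C) a b)
          have h2 : Commute (a ^ m) (b ^ m) :=
            (Subgroup.mem_center_iff.1 ((Subgroup.center C).pow_index_mem a) (b ^ m)).symm
          rw [pow_mul, h1, h2.mul_pow, pow_mul, pow_mul]
        exact Subtype.ext (by simpa using congrArg Subtype.val h) }
  have hinj : Function.Injective f := by
    have hN : f.ker.map C.subtype = ⊥ := by
      refine hfin _ ⟨?_⟩ ?_
      · rintro _ ⟨c, hc, rfl⟩ g
        have hc' : (c : G) ^ (m * r) = 1 := congrArg Subtype.val hc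
        have hCn : C.Normal := inferInstance
        refine ⟨⟨g * c * g⁻¹, hCn.conj_mem _ c.2 g⟩, Subtype.ext ?_, rfl⟩
        change (g * c * g⁻¹) ^ (m * r) = 1
        rw [conj_pow, hc']; simp
      · refine Finite.of_injective (fun n : f.ker.map C.subtype => (n : G ⧸ H)) ?_
        rintro ⟨_, c, hc, rfl⟩ ⟨_, d, hd, rfl⟩ hcd
        have h1 : (c : G)⁻¹ * d ∈ H := QuotientGroup.eq.1 hcd
        have h2 : (c⁻¹ * d) ∈ f.ker := f.ker.mul_mem (f.ker.inv_mem hc) hd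
        have h3 : ((c : G)⁻¹ * d) ^ (m * r) = 1 := congrArg Subtype.val h2
        have h4 := htor _ h1 (isOfFinOrder_iff_pow_eq_one.2 ⟨m * r, by positivity, h3⟩)
        exact Subtype.ext (inv_mul_eq_one.1 h4)
    rw [← MonoidHom.ker_eq_bot_iff]
    exact (Subgroup.map_eq_bot_iff_of_injective _ C.subtype_injective).1 hN
  refine ⟨isCyclic_of_injective f hinj, fun c hc hcf => ?_⟩
  have h1 : f ⟨c, hc⟩ = f 1 := by
    rw [map_one]
    exact Subtype.ext (htor _ (hpow c) hcf.pow)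
  exact congrArg Subtype.val (hinj h1)

/-- A group generated by involutions, without nontrivial finite normal subgroups, and with an
infinite cyclic subgroup of finite index is isomorphic to `D_∞`. -/
theorem nonempty_mulEquiv_DInfty_of_no_finite_normal
    (hgen : Subgroup.closure {g : G | g * g = 1} = ⊤)
    (hfin : ∀ N : Subgroup G, N.Normal → Finite N → N = ⊥)
    (x : G) (hx : ¬ IsOfFinOrder x) [(Subgroup.zpowers x).FiniteIndex] :
    Nonempty (G ≃* DInfty) := by
  obtain ⟨y, hyH, hy⟩ : ∃ y : G, Subgroup.zpowers y = (Subgroup.zpowers x).normalCore ∧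
      ¬ IsOfFinOrder y := by
    obtain ⟨k, hk⟩ := Subgroup.exists_pow_mem_of_index_ne_zero
      (Subgroup.FiniteIndex.index_ne_zero (H := (Subgroup.zpowers x).normalCore)) x
    obtain ⟨y, hy⟩ : ∃ y : G, Subgroup.zpowers y = (Subgroup.zpowers x).normalCore := by
      have : IsCyclic (Subgroup.zpowers x).normalCore :=
        isCyclic_of_injective (Subgroup.inclusion (Subgroup.zpowers x).normalCore_le)
          (Subgroup.inclusion_injective _)
      exact (Subgroup.isCyclic_iff_exists_zpowers_eq_top _).1 this
    refine ⟨y, hy, fun hfo => hx ?_⟩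
    have h := hk.2.2
    rw [← hy] at h
    obtain ⟨l, hl⟩ := h
    have h' : IsOfFinOrder (x ^ k) := by
      rw [← hl]
      exact hfo.zpow
    exact (isOfFinOrder_pow.1 h').resolve_right hk.1.ne'
  have : (Subgroup.zpowers y).Normal := hyH ▸ inferInstance
  have : (Subgroup.zpowers y).FiniteIndex := hyH ▸ inferInstance
  obtain ⟨hcyc, htor⟩ := isCyclic_centralizer_of_no_finite_normal hfin hy
  set C := Subgroup.centralizer (Subgroup.zpowers y : Set G) with hC
  have hCn : C.Normal := inferInstance
  obtain ⟨z, hzC⟩ := (Subgroup.isCyclic_iff_exists_zpowers_eq_top _).1 hcyc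
  have hyC : y ∈ C := by
    rw [hC, Subgroup.mem_centralizer_iff]
    rintro _ ⟨k, rfl⟩
    exact (Commute.refl y).zpow_left k
  have hyz : y ∈ Subgroup.zpowers z := hzC ▸ hyC
  have hz : ¬ IsOfFinOrder z := by
    obtain ⟨k, rfl⟩ := hyz
    exact fun h => hy h.zpow
  have hcomm (g : G) (hg : g * z * g⁻¹ = z) : g ∈ C := by
    have h1 : Commute g z := mul_inv_eq_iff_eq_mul.1 hg
    obtain ⟨k, rfl⟩ := hyz
    rw [hC, Subgroup.mem_centralizer_iff]
    rintro _ ⟨l, rfl⟩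
    exact (((h1.zpow_right k).zpow_right l).eq).symm
  have hconj (g : G) : g * z * g⁻¹ = z ∨ g * z * g⁻¹ = z⁻¹ := by
    have hmem (g : G) : ∃ e : ℤ, z ^ e = g * z * g⁻¹ := by
      have : g * z * g⁻¹ ∈ Subgroup.zpowers z :=
        hzC ▸ hCn.conj_mem z (hzC ▸ Subgroup.mem_zpowers z) g
      exact this
    obtain ⟨e, he⟩ := hmem g
    obtain ⟨e', he'⟩ := hmem g⁻¹
    have h : z ^ (e * e') = z ^ (1 : ℤ) := by
      rw [zpow_mul, he, conj_zpow, he']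
      group
    have h' := injective_zpow_iff_not_isOfFinOrder.2 hz h
    obtain rfl | rfl := Int.isUnit_iff.1 (IsUnit.of_mul_eq_one _ h')
    · left; rw [← he, zpow_one]
    · right; rw [← he, zpow_neg_one]
  obtain ⟨s, hs, hs1⟩ : ∃ s : G, s * s = 1 ∧ s ≠ 1 := by
    by_contra! h
    have h1 : Subgroup.closure {g : G | g * g = 1} ≤ ⊥ :=
      (Subgroup.closure_le _).2 fun g hg => h g hg
    rw [hgen] at h1
    exact hx ((Subgroup.mem_bot.1 (h1 (Subgroup.mem_top x))) ▸ IsOfFinOrder.one)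
  have hsC : s ∉ C := fun h =>
    hs1 (htor s h (isOfFinOrder_iff_pow_eq_one.2 ⟨2, two_pos, by rw [pow_two, hs]⟩))
  have hsinv : s⁻¹ = s := inv_eq_of_mul_eq_one_right hs
  have hsz : s * z * s⁻¹ = z⁻¹ := (hconj s).resolve_left fun h => hsC (hcomm s h)
  refine nonempty_mulEquiv_DInfty hs (by rwa [hsinv] at hsz) hz (hzC ▸ hsC) fun g => ?_
  rw [hzC]
  refine (hconj g).imp (hcomm g) fun hg => hcomm _ ?_
  calc s * g * z * (s * g)⁻¹ = s * (g * z * g⁻¹) * s⁻¹ := by group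
    _ = (s * z * s⁻¹)⁻¹ := by rw [hg]; group
    _ = z := by rw [hsz, inv_inv]

end VirtuallyCyclic

section GeometricRepresentation

open Real Polynomial.Chebyshev

variable {B : Type*} (M : CoxeterMatrix B)

/-- The simple root attached to `i`, a basis vector of the geometric representation. -/
noncomputable def simpleRoot (i : B) : B →₀ ℝ := Finsupp.single i 1

/-- The simple coroot attached to `i`: it takes the value `-2 cos (π / M i j)` at the simple root
of `j`. For `M i j = 0`, which encodes `∞`, this is `-2` because of `π / 0 = 0`. -/
noncomputable def simpleCoroot (i : B) : Module.Dual ℝ (B →₀ ℝ) :=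
  Finsupp.linearCombination ℝ fun j => -2 * cos (π / M i j)

theorem simpleCoroot_simpleRoot (i j : B) :
    simpleCoroot M i (simpleRoot j) = -2 * cos (π / M i j) := by
  simp [simpleCoroot, simpleRoot]

theorem simpleCoroot_simpleRoot_self (i : B) : simpleCoroot M i (simpleRoot i) = 2 := by
  simp [simpleCoroot_simpleRoot]

theorem simpleCoroot_simpleRoot_comm (i j : B) :
    simpleCoroot M i (simpleRoot j) = simpleCoroot M j (simpleRoot i) := by
  rw [simpleCoroot_simpleRoot, simpleCoroot_simpleRoot, M.symmetric]

variable {M} in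
theorem coxeterMatrix_two_le_of_ne {i j : B} (hij : i ≠ j) (h0 : M i j ≠ 0) : 2 ≤ M i j := by
  have := M.off_diagonal i j hij
  omega

theorem simpleCoroot_simpleRoot_ne_zero {i j : B} (hij : i ≠ j) (h2 : M i j ≠ 2) :
    simpleCoroot M i (simpleRoot j) ≠ 0 := by
  rw [simpleCoroot_simpleRoot]
  refine mul_ne_zero (by norm_num) ?_
  rcases eq_or_ne (M i j) 0 with h0 | h0
  · simp [h0]
  have h3 : 3 ≤ M i j := by
    have := coxeterMatrix_two_le_of_ne hij h0
    omega
  have h3' : (3 : ℝ) ≤ M i j := by exact_mod_cast h3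
  refine (cos_pos_of_mem_Ioo ⟨?_, ?_⟩).ne'
  · have : 0 < π / M i j := by positivity
    linarith [pi_pos]
  · exact div_lt_div_of_pos_left pi_pos two_pos (by linarith)

/-- The simple reflection of the geometric representation attached to `i`. -/
noncomputable def simpleReflection (i : B) : (B →₀ ℝ) ≃ₗ[ℝ] (B →₀ ℝ) :=
  Module.reflection (simpleCoroot_simpleRoot_self M i)

theorem simpleReflection_apply (i : B) (v : B →₀ ℝ) :
    simpleReflection M i v = v - simpleCoroot M i v • simpleRoot i :=
  Module.reflection_apply _ _

theorem simpleReflection_simpleRoot_self (i : B) :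
    simpleReflection M i (simpleRoot i) = -simpleRoot i :=
  Module.reflection_apply_self _

theorem isLiftable_simpleReflection : M.IsLiftable (simpleReflection M) := by
  intro i j
  rcases eq_or_ne i j with rfl | hij
  · rw [M.diagonal, pow_one]
    refine LinearEquiv.ext fun v => ?_
    rw [LinearEquiv.mul_apply, LinearEquiv.coe_one, id]
    exact Module.involutive_reflection (simpleCoroot_simpleRoot_self M i) v
  rcases eq_or_ne (M i j) 0 with h0 | h0
  · rw [h0, pow_zero]
  have hm2 := coxeterMatrix_two_le_of_ne hij h0
  have hji := simpleCoroot_simpleRoot_comm M i j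
  have hc := simpleCoroot_simpleRoot M i j
  set θ := π / M i j with hθ
  have hmθ : M i j * θ = π := by rw [hθ]; field_simp
  have hθ0 : 0 < θ := by positivity
  have ht : simpleCoroot M i (simpleRoot j) * simpleCoroot M j (simpleRoot i) - 2 =
      2 * cos (2 * θ) := by
    rw [← hji, hc, cos_two_mul]; ring
  refine LinearEquiv.ext fun v => ?_
  refine (Module.reflection_mul_reflection_pow_apply (simpleCoroot_simpleRoot_self M i)
    (simpleCoroot_simpleRoot_self M j) (M i j) v (2 * cos (2 * θ)) ht.symm).trans ?_
  rw [LinearEquiv.coe_one, id]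
  rcases hm2.eq_or_lt with h2 | h3
  · have hθ2 : θ = π / 2 := by rw [hθ, ← h2]; norm_num
    have h0' : simpleCoroot M i (simpleRoot j) = 0 := by rw [hc, hθ2]; simp
    have hcos : 2 * cos (2 * θ) = -2 := by rw [hθ2, mul_div_cancel₀ _ two_ne_zero]; simp
    rw [← hji, h0', hcos, ← h2]
    norm_num
    module
  · have hs : 0 < sin (2 * θ) := by
      have h3' : (3 : ℝ) ≤ M i j := by exact_mod_cast h3
      exact sin_pos_of_pos_of_lt_pi (by positivity) (by nlinarith)
    have hS (k : ℤ) : (S ℝ k).eval (2 * cos (2 * θ)) * sin (2 * θ) = sin ((k + 1) * (2 * θ)) :=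
      S_two_mul_real_cos _ _
    obtain ⟨k, hk | hk⟩ := Nat.even_or_odd' (M i j)
    · have h1 : (S ℝ ((k : ℤ) - 1)).eval (2 * cos (2 * θ)) = 0 := by
        have h := hS (k - 1)
        have hkθ : ((k - 1 : ℤ) + 1 : ℝ) * (2 * θ) = π := by
          rw [hk] at hmθ; push_cast at hmθ ⊢; linarith
        rw [hkθ, sin_pi] at h
        exact (mul_eq_zero.1 h).resolve_right hs.ne'
      have e1 : (((M i j : ℕ) : ℤ) - 2) / 2 = k - 1 := by omega
      have e2 : (((M i j : ℕ) : ℤ) - 1) / 2 = k - 1 := by omega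
      simp [e1, e2, h1]
    · have h1 : (S ℝ (k : ℤ)).eval (2 * cos (2 * θ)) +
          (S ℝ ((k : ℤ) - 1)).eval (2 * cos (2 * θ)) = 0 := by
        have h := hS (k - 1)
        have h' := hS k
        have hkθ : ((k : ℤ) + 1 : ℝ) * (2 * θ) =
            2 * π - ((k - 1 : ℤ) + 1 : ℝ) * (2 * θ) := by
          rw [hk] at hmθ; push_cast at hmθ ⊢; linarith
        rw [hkθ, sin_two_pi_sub, ← h] at h'
        refine (mul_eq_zero.1 (?_ : _ * sin (2 * θ) = 0)).resolve_right hs.ne'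
        linarith
      have e1 : (((M i j : ℕ) : ℤ) - 2) / 2 = k - 1 := by omega
      have e2 : (((M i j : ℕ) : ℤ) - 1) / 2 = k := by omega
      have e3 : (((M i j : ℕ) : ℤ) - 3) / 2 = k - 1 := by omega
      have e4 : ((M i j : ℕ) : ℤ) / 2 = k := by omega
      simp [e1, e2, e3, e4, h1]

variable {M} {W : Type*} [Group W] (cs : CoxeterSystem M W)

/-- The geometric representation of a Coxeter group. -/
noncomputable def geometricRep : W →* ((B →₀ ℝ) ≃ₗ[ℝ] (B →₀ ℝ)) :=
  cs.lift ⟨_, isLiftable_simpleReflection M⟩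

theorem geometricRep_simple (i : B) : geometricRep cs (cs.simple i) = simpleReflection M i :=
  cs.lift_apply_simple (isLiftable_simpleReflection M) i

theorem geometricRep_mul_apply (w w' : W) (v : B →₀ ℝ) :
    geometricRep cs (w * w') v = geometricRep cs w (geometricRep cs w' v) := by
  rw [map_mul]; rfl

theorem geometricRep_mul_simple_simpleRoot (w : W) (i : B) :
    geometricRep cs (w * cs.simple i) (simpleRoot i) = -geometricRep cs w (simpleRoot i) := by
  rw [geometricRep_mul_apply, geometricRep_simple, simpleReflection_simpleRoot_self, map_neg]

theorem geometricRep_inv_apply_self (w : W) (v : B →₀ ℝ) :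
    geometricRep cs w⁻¹ (geometricRep cs w v) = v := by
  rw [← geometricRep_mul_apply, inv_mul_cancel, map_one]; rfl

/-- The sequence `sin (k θ) / sin θ` for `θ = π / m`, which is `k` for `m = 0`; it gives the
coordinates of the roots of a dihedral group. -/
noncomputable def dihedralCoeff (m : ℕ) (k : ℕ) : ℝ :=
  (U ℝ ((k : ℤ) - 1)).eval (cos (π / m))

theorem dihedralCoeff_zero (m : ℕ) : dihedralCoeff m 0 = 0 := by simp [dihedralCoeff]

theorem dihedralCoeff_one (m : ℕ) : dihedralCoeff m 1 = 1 := by simp [dihedralCoeff]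

theorem dihedralCoeff_add_two (m k : ℕ) :
    dihedralCoeff m (k + 2) =
      2 * cos (π / m) * dihedralCoeff m (k + 1) - dihedralCoeff m k := by
  have h := congrArg (Polynomial.eval (cos (π / m))) (U_add_two ℝ ((k : ℤ) - 1))
  have e : (k : ℤ) - 1 + 2 = k + 2 - 1 := by ring
  simpa [dihedralCoeff, e] using h

theorem dihedralCoeff_nonneg {m k : ℕ} (h1 : m ≠ 1) (h : m ≠ 0 → k ≤ m) :
    0 ≤ dihedralCoeff m k := by
  rcases eq_or_ne m 0 with rfl | h0
  · have h := U_eval_one (R := ℝ) ((k : ℤ) - 1)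
    simp [dihedralCoeff, h]
  have hm : (2 : ℝ) ≤ m := by
    have : 2 ≤ m := by omega
    exact_mod_cast this
  have hk : (k : ℝ) ≤ m := by exact_mod_cast h h0
  have hθ : (m : ℝ) * (π / m) = π := by field_simp
  have hθ0 : 0 < π / m := by positivity
  have hs : 0 < sin (π / m) := sin_pos_of_pos_of_lt_pi hθ0 (by nlinarith)
  have hU : dihedralCoeff m k * sin (π / m) = sin (k * (π / m)) := by
    simp [dihedralCoeff]
  refine nonneg_of_mul_nonneg_left ?_ hs
  rw [hU]
  exact sin_nonneg_of_nonneg_of_le_pi (by positivity) (by nlinarith)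

theorem geometricRep_alternatingWord_simpleRoot (i j : B) (k : ℕ) :
    geometricRep cs (cs.wordProd (CoxeterSystem.alternatingWord i j k)) (simpleRoot i) =
      dihedralCoeff (M i j) (if Even k then k + 1 else k) • simpleRoot i +
        dihedralCoeff (M i j) (if Even k then k else k + 1) • simpleRoot j := by
  induction k with
  | zero =>
    simp [CoxeterSystem.alternatingWord, dihedralCoeff_zero, dihedralCoeff_one]
  | succ k ih =>
    rw [CoxeterSystem.alternatingWord_succ', cs.wordProd_cons, geometricRep_mul_apply, ih,
      geometricRep_simple, simpleReflection_apply]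
    have hij := simpleCoroot_simpleRoot M i j
    have hji := (simpleCoroot_simpleRoot_comm M i j).symm.trans hij
    have hadd := dihedralCoeff_add_two (M i j) k
    by_cases hk : Even k
    · have hk' : ¬ Even (k + 1) := by simpa [Nat.even_add_one] using hk
      simp only [hk, hk', if_true, if_false, map_add, map_smul, hji,
        simpleCoroot_simpleRoot_self, smul_eq_mul, hadd]
      module
    · have hk' : Even (k + 1) := by simpa [Nat.even_add_one] using hk
      simp only [hk, hk', if_true, if_false, map_add, map_smul, hij,
        simpleCoroot_simpleRoot_self, smul_eq_mul, hadd]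
      module

theorem simpleRoot_nonneg (i : B) : 0 ≤ simpleRoot i := Finsupp.single_nonneg.2 zero_le_one

theorem simpleRoot_ne_zero (i : B) : simpleRoot i ≠ 0 := by simp [simpleRoot]

/-- A right descent `t` of `w` and `s ≠ t` give a factorization of `w` by an element of the
dihedral group `⟨s, t⟩` and an element `v` having neither `s` nor `t` as a right descent. -/
theorem exists_dihedral_factorization {w : W} {s t : B} (ht : cs.IsRightDescent w t) :
    ∃ (v : W) (k : ℕ), w = v * cs.wordProd (CoxeterSystem.alternatingWord s t k) ∧
      cs.length w = cs.length v + k ∧ 0 < k ∧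
      ¬ cs.IsRightDescent v s ∧ ¬ cs.IsRightDescent v t := by
  classical
  let P : ℕ → Prop := fun k => ∃ v : W,
    w = v * cs.wordProd (CoxeterSystem.alternatingWord s t k) ∧ cs.length w = cs.length v + k
  have hP1 : P 1 := by
    refine ⟨w * cs.simple t, ?_, ((cs.isRightDescent_iff).1 ht).symm⟩
    simp [CoxeterSystem.alternatingWord]
  have hbound (k : ℕ) (hk : P k) : k ≤ cs.length w := by
    obtain ⟨v, -, h⟩ := hk
    omega
  set k := Nat.findGreatest P (cs.length w) with hk
  obtain ⟨v, hv, hl⟩ : P k := Nat.findGreatest_spec (hbound 1 hP1) hP1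
  have hk1 : 1 ≤ k := Nat.le_findGreatest (hbound 1 hP1) hP1
  have hmax : ¬ P (k + 1) := fun h => by
    have := Nat.le_findGreatest (hbound _ h) h
    omega
  have hnext : ¬ cs.IsRightDescent v (if Even k then t else s) := by
    intro hd
    refine hmax ⟨v * cs.simple (if Even k then t else s), ?_, ?_⟩
    · rw [CoxeterSystem.alternatingWord_succ', cs.wordProd_cons, mul_assoc,
        cs.simple_mul_simple_cancel_left]
      exact hv
    · have := (cs.isRightDescent_iff).1 hd
      omega
  have hprev : ¬ cs.IsRightDescent v (if Even k then s else t) := by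
    intro hd
    obtain ⟨l, hl'⟩ : ∃ l, k = l + 1 := ⟨k - 1, by omega⟩
    have hif : (if Even k then s else t) = if Even l then t else s := by
      rw [hl']
      by_cases h : Even l <;> simp [Nat.even_add_one, h]
    rw [hif] at hd
    have hw : w = v * cs.simple (if Even l then t else s) *
        cs.wordProd (CoxeterSystem.alternatingWord s t l) := by
      rw [mul_assoc, ← cs.wordProd_cons, ← CoxeterSystem.alternatingWord_succ', ← hl']
      exact hv
    have h1 := cs.length_mul_le (v * cs.simple (if Even l then t else s))
      (cs.wordProd (CoxeterSystem.alternatingWord s t l))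
    rw [← hw] at h1
    have h2 := cs.length_wordProd_le (CoxeterSystem.alternatingWord s t l)
    rw [CoxeterSystem.length_alternatingWord] at h2
    have h3 := (cs.isRightDescent_iff).1 hd
    omega
  refine ⟨v, k, hv, hl, hk1, ?_⟩
  by_cases h : Even k
  · rw [if_pos h] at hnext hprev
    exact ⟨hprev, hnext⟩
  · rw [if_neg h] at hnext hprev
    exact ⟨hnext, hprev⟩

theorem geometricRep_simpleRoot_nonneg {w : W} {s : B} (hs : ¬ cs.IsRightDescent w s) :
    0 ≤ geometricRep cs w (simpleRoot s) := by
  induction hn : cs.length w using Nat.strong_induction_on generalizing w s with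
  | _ n ih =>
    rcases eq_or_ne w 1 with rfl | hw
    · rw [map_one]; exact simpleRoot_nonneg s
    obtain ⟨t, ht⟩ := cs.exists_rightDescent_of_ne_one hw
    have hst : s ≠ t := by rintro rfl; exact hs ht
    obtain ⟨v, k, hv, hl, hk, hvs, hvt⟩ := exists_dihedral_factorization cs (s := s) ht
    have hkm : M s t ≠ 0 → k + 1 ≤ M s t := by
      intro h0
      by_contra hlt
      refine cs.not_isReduced_alternatingWord t s (m := k + 1) (by rwa [M.symmetric])
        (by rw [M.symmetric]; omega) ?_
      have h1 := cs.length_mul_le v (cs.wordProd (CoxeterSystem.alternatingWord t s (k + 1)))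
      have h2 := cs.length_wordProd_le (CoxeterSystem.alternatingWord t s (k + 1))
      have h3 : v * cs.wordProd (CoxeterSystem.alternatingWord t s (k + 1)) =
          w * cs.simple s := by
        rw [CoxeterSystem.alternatingWord_succ, cs.wordProd_concat, ← mul_assoc, ← hv]
      rw [h3, (cs.not_isRightDescent_iff).1 hs] at h1
      rw [CoxeterSystem.IsReduced]
      rw [CoxeterSystem.length_alternatingWord] at h2 ⊢
      omega
    have hlt : cs.length v < n := by omega
    have h1 : M s t ≠ 1 := M.off_diagonal s t hst
    rw [hv, geometricRep_mul_apply, geometricRep_alternatingWord_simpleRoot, map_add, map_smul,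
      map_smul]
    refine add_nonneg (smul_nonneg (dihedralCoeff_nonneg h1 fun h0 => ?_) (ih _ hlt hvs rfl))
      (smul_nonneg (dihedralCoeff_nonneg h1 fun h0 => ?_) (ih _ hlt hvt rfl))
    all_goals have := hkm h0; split_ifs <;> omega

theorem geometricRep_simpleRoot_nonpos {w : W} {s : B} (hs : cs.IsRightDescent w s) :
    geometricRep cs w (simpleRoot s) ≤ 0 := by
  have h := geometricRep_simpleRoot_nonneg cs
    ((cs.isRightDescent_iff_not_isRightDescent_mul).1 hs)
  rw [geometricRep_mul_simple_simpleRoot] at h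
  exact neg_nonneg.1 h

/-- The geometric representation is faithful. -/
theorem eq_one_of_geometricRep_simpleRoot {w : W}
    (h : ∀ i, geometricRep cs w (simpleRoot i) = simpleRoot i) : w = 1 := by
  by_contra hw
  obtain ⟨i, hi⟩ := cs.exists_rightDescent_of_ne_one hw
  have h1 := geometricRep_simpleRoot_nonpos cs hi
  rw [h] at h1
  exact simpleRoot_ne_zero i (le_antisymm h1 (simpleRoot_nonneg i))

variable (M) in
/-- Twice the invariant bilinear form of the geometric representation. -/
noncomputable def coxeterForm : (B →₀ ℝ) →ₗ[ℝ] Module.Dual ℝ (B →₀ ℝ) :=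
  Finsupp.linearCombination ℝ (simpleCoroot M)

variable (M) in
theorem coxeterForm_simpleRoot (i : B) : coxeterForm M (simpleRoot i) = simpleCoroot M i := by
  simp [coxeterForm, simpleRoot]

variable (M) in
theorem coxeterForm_apply_simpleRoot (v : B →₀ ℝ) (i : B) :
    coxeterForm M v (simpleRoot i) = simpleCoroot M i v := by
  induction v using Finsupp.induction_linear with
  | zero => simp
  | add u v hu hv => simp [hu, hv]
  | single j c =>
    have h : Finsupp.single j c = c • simpleRoot j := by simp [simpleRoot]
    rw [h, map_smul, map_smul, LinearMap.smul_apply, coxeterForm_simpleRoot,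
      simpleCoroot_simpleRoot_comm]

theorem coxeterForm_geometricRep (w : W) (u v : B →₀ ℝ) :
    coxeterForm M (geometricRep cs w u) (geometricRep cs w v) = coxeterForm M u v := by
  induction w using cs.simple_induction_left with
  | one => rw [map_one]; rfl
  | mul_simple_left w i hw =>
    rw [geometricRep_mul_apply, geometricRep_mul_apply, geometricRep_simple,
      simpleReflection_apply, simpleReflection_apply, ← hw]
    simp only [map_sub, map_smul, LinearMap.sub_apply, LinearMap.smul_apply,
      coxeterForm_simpleRoot, coxeterForm_apply_simpleRoot, simpleCoroot_simpleRoot_self,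
      smul_eq_mul]
    ring

/-- The roots of a Coxeter system. -/
def rootSet : Set (B →₀ ℝ) :=
  {β | ∃ (w : W) (i : B), β = geometricRep cs w (simpleRoot i)}

variable {cs}

theorem geometricRep_mem_rootSet {β : B →₀ ℝ} (hβ : β ∈ rootSet cs) (w : W) :
    geometricRep cs w β ∈ rootSet cs := by
  obtain ⟨w', i, rfl⟩ := hβ
  exact ⟨w * w', i, by rw [geometricRep_mul_apply]⟩

theorem neg_mem_rootSet {β : B →₀ ℝ} (hβ : β ∈ rootSet cs) : -β ∈ rootSet cs := by
  obtain ⟨w, i, rfl⟩ := hβ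
  exact ⟨w * cs.simple i, i, by rw [geometricRep_mul_simple_simpleRoot]⟩

theorem nonneg_or_nonpos_of_mem_rootSet {β : B →₀ ℝ} (hβ : β ∈ rootSet cs) : 0 ≤ β ∨ β ≤ 0 := by
  obtain ⟨w, i, rfl⟩ := hβ
  by_cases h : cs.IsRightDescent w i
  · exact Or.inr (geometricRep_simpleRoot_nonpos cs h)
  · exact Or.inl (geometricRep_simpleRoot_nonneg cs h)

theorem coxeterForm_self_of_mem_rootSet {β : B →₀ ℝ} (hβ : β ∈ rootSet cs) :
    coxeterForm M β β = 2 := by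
  obtain ⟨w, i, rfl⟩ := hβ
  rw [coxeterForm_geometricRep, coxeterForm_simpleRoot, simpleCoroot_simpleRoot_self]

theorem ne_zero_of_mem_rootSet {β : B →₀ ℝ} (hβ : β ∈ rootSet cs) : β ≠ 0 := by
  rintro rfl
  simpa using coxeterForm_self_of_mem_rootSet hβ

/-- A simple reflection permutes the positive roots other than its own simple root. -/
theorem eq_simpleRoot_of_simple_nonpos {β : B →₀ ℝ} (hβ : β ∈ rootSet cs) (hpos : 0 ≤ β) {i : B}
    (hneg : geometricRep cs (cs.simple i) β ≤ 0) : β = simpleRoot i := by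
  rw [geometricRep_simple, simpleReflection_apply] at hneg
  have hβi : β = β i • simpleRoot i := by
    ext b
    rcases eq_or_ne i b with rfl | hb
    · simp [simpleRoot]
    · have hz : simpleRoot i b = 0 := Finsupp.single_eq_of_ne hb.symm
      have h1 : β b - simpleCoroot M i β * simpleRoot i b ≤ 0 := hneg b
      have h2 : 0 ≤ β b := hpos b
      rw [hz, mul_zero, sub_zero] at h1
      rw [Finsupp.smul_apply, hz, smul_zero]
      exact le_antisymm h1 h2
  have h := coxeterForm_self_of_mem_rootSet hβ
  have hi : 0 ≤ β i := hpos i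
  rw [hβi, map_smul, map_smul, LinearMap.smul_apply, coxeterForm_simpleRoot,
    simpleCoroot_simpleRoot_self, smul_eq_mul, smul_eq_mul] at h
  have h1 : β i = 1 := by nlinarith
  rw [hβi, h1, one_smul]

variable (cs)

/-- Every element of a Coxeter group makes only finitely many positive roots negative. -/
theorem finite_setOf_geometricRep_nonpos (w : W) :
    {β | β ∈ rootSet cs ∧ 0 ≤ β ∧ geometricRep cs w β ≤ 0}.Finite := by
  induction w using cs.simple_induction_left with
  | one =>
    refine Set.finite_empty.subset ?_
    rintro β ⟨hβ, h0, h1⟩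
    rw [map_one] at h1
    exact ne_zero_of_mem_rootSet hβ (le_antisymm h1 h0)
  | mul_simple_left w i hw =>
    refine (hw.insert (geometricRep cs w⁻¹ (simpleRoot i))).subset ?_
    rintro β ⟨hβ, h0, h1⟩
    rcases nonneg_or_nonpos_of_mem_rootSet (geometricRep_mem_rootSet hβ w) with h | h
    · left
      rw [geometricRep_mul_apply] at h1
      rw [← eq_simpleRoot_of_simple_nonpos (geometricRep_mem_rootSet hβ w) h h1,
        geometricRep_inv_apply_self]
    · exact Or.inr ⟨hβ, h0, h⟩

theorem finite_of_finite_rootSet [Finite B] (h : (rootSet cs).Finite) : Finite W := by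
  have : Finite (rootSet cs) := h
  refine Finite.of_injective
    (fun w (i : B) => (⟨geometricRep cs w (simpleRoot i), w, i, rfl⟩ : rootSet cs)) ?_
  intro w w' hww
  refine (inv_mul_eq_one (a := w) (b := w')).1 (eq_one_of_geometricRep_simpleRoot cs fun i => ?_)
  have hi := congrArg Subtype.val (congrFun hww i)
  dsimp only at hi
  rw [geometricRep_mul_apply, ← hi, geometricRep_inv_apply_self]

/-- If the elements of a finite subset of `W` containing `1` sum to zero in the geometric
representation, then `W` is finite. -/
theorem finite_of_sum_geometricRep_eq_zero [Finite B] (N : Finset W) (h1 : 1 ∈ N)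
    (hN : ∀ v, ∑ n ∈ N, geometricRep cs n v = 0) : Finite W := by
  have hpos : {β | β ∈ rootSet cs ∧ 0 ≤ β}.Finite := by
    refine (N.finite_toSet.biUnion fun n _ => finite_setOf_geometricRep_nonpos cs n).subset ?_
    rintro β ⟨hβ, h0⟩
    by_contra hcon
    simp only [Set.mem_iUnion, Set.mem_ofPred_eq, not_exists, not_and] at hcon
    have hnn (n : W) (hn : n ∈ N) : 0 ≤ geometricRep cs n β :=
      (nonneg_or_nonpos_of_mem_rootSet (geometricRep_mem_rootSet hβ n)).resolve_right
        (hcon n hn hβ h0)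
    have h := (Finset.sum_eq_zero_iff_of_nonneg hnn).1 (hN β) 1 h1
    rw [map_one] at h
    exact ne_zero_of_mem_rootSet hβ h
  refine finite_of_finite_rootSet cs ((hpos.union (hpos.image Neg.neg)).subset fun β hβ => ?_)
  rcases nonneg_or_nonpos_of_mem_rootSet hβ with h | h
  · exact Or.inl ⟨hβ, h⟩
  · exact Or.inr ⟨-β, ⟨neg_mem_rootSet hβ, neg_nonneg.2 h⟩, neg_neg β⟩

/-- In the geometric representation of an irreducible Coxeter group, every proper invariant
subspace is contained in the radical of the form. -/
theorem eq_top_or_simpleCoroot_eq_zero (hirr : IsIrreducible M) (U : Submodule ℝ (B →₀ ℝ))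
    (hU : ∀ w, ∀ u ∈ U, geometricRep cs w u ∈ U) :
    U = ⊤ ∨ ∀ u ∈ U, ∀ i, simpleCoroot M i u = 0 := by
  have hdiff (u : B →₀ ℝ) (hu : u ∈ U) (j : B) (hj : simpleCoroot M j u ≠ 0) :
      simpleRoot j ∈ U := by
    have h := U.sub_mem hu (hU (cs.simple j) u hu)
    rw [geometricRep_simple, simpleReflection_apply, sub_sub_cancel] at h
    exact (U.smul_mem_iff hj).1 h
  by_cases h : ∃ i, simpleRoot i ∈ U
  · left
    obtain ⟨i, hi⟩ := h
    have hall (j : B) : simpleRoot j ∈ U := by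
      obtain ⟨p⟩ := hirr.preconnected i j
      induction p with
      | nil => exact hi
      | cons hadj _ ih =>
        refine ih (hdiff _ hi _ (simpleCoroot_simpleRoot_ne_zero M hadj.ne' ?_))
        rcases ((SimpleGraph.fromRel_adj _ _ _).1 hadj).2 with h | h
        · rwa [M.symmetric]
        · exact h
    rw [eq_top_iff]
    intro v _
    induction v using Finsupp.induction_linear with
    | zero => exact U.zero_mem
    | add u v hu hv => exact U.add_mem (hu trivial) (hv trivial)
    | single j c => simpa [simpleRoot] using U.smul_mem c (hall j)
  · right
    intro u hu i
    by_contra hne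
    exact h ⟨i, hdiff u hu i hne⟩

/-- An infinite irreducible Coxeter group has no nontrivial finite normal subgroup. -/
theorem eq_bot_of_normal_of_finite (cs : CoxeterSystem M W) [Finite B] [Infinite W]
    (hirr : IsIrreducible M)
    (N : Subgroup W) (hN : N.Normal) (hfin : Finite N) : N = ⊥ := by
  classical
  have : Fintype N := Fintype.ofFinite N
  let ρ (w : W) : Module.End ℝ (B →₀ ℝ) := (geometricRep cs w).toLinearMap
  let P : Module.End ℝ (B →₀ ℝ) := ∑ n : N, ρ n
  have hP (v : B →₀ ℝ) : P v = ∑ n : N, geometricRep cs n v := by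
    simp [P, ρ, LinearMap.sum_apply]
  have hPw (w : W) (v : B →₀ ℝ) : P (geometricRep cs w v) = geometricRep cs w (P v) := by
    rw [hP, hP, map_sum]
    refine Fintype.sum_equiv (MulAut.conjNormal (w⁻¹)).toEquiv _ _ fun n => ?_
    rw [← geometricRep_mul_apply, ← geometricRep_mul_apply]
    congr 2
    simp [mul_assoc]
  have hPn (n : N) (v : B →₀ ℝ) : P (geometricRep cs n v) = P v := by
    rw [hP, hP]
    refine Fintype.sum_equiv (Equiv.mulRight n) _ _ fun m => ?_
    rw [← geometricRep_mul_apply]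
    rfl
  have hnP (n : N) (v : B →₀ ℝ) : geometricRep cs n (P v) = P v := by
    rw [← hPw, hPn]
  have hker : ∀ u, P u = 0 → ∀ i, simpleCoroot M i u = 0 := by
    refine (eq_top_or_simpleCoroot_eq_zero cs hirr (LinearMap.ker P) ?_).resolve_left ?_
    · intro w u hu
      rw [LinearMap.mem_ker] at hu ⊢
      rw [hPw, hu, map_zero]
    · intro htop
      refine not_finite_iff_infinite.2 ‹Infinite W› (finite_of_sum_geometricRep_eq_zero cs
        (Finset.univ.image ((↑) : N → W)) ?_ fun v => ?_)
      · exact Finset.mem_image.2 ⟨1, Finset.mem_univ _, rfl⟩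
      · rw [Finset.sum_image (fun _ _ _ _ h => Subtype.ext h), ← hP]
        exact LinearMap.mem_ker.1 (htop ▸ Submodule.mem_top)
  let F : Submodule ℝ (B →₀ ℝ) := ⨅ n : N, LinearMap.ker (ρ n - 1)
  have hF (v : B →₀ ℝ) : v ∈ F ↔ ∀ n : N, geometricRep cs n v = v := by
    simp [F, ρ, Submodule.mem_iInf, sub_eq_zero]
  have hFtop : F = ⊤ := by
    refine (eq_top_or_simpleCoroot_eq_zero cs hirr F ?_).resolve_right ?_
    · intro w u hu
      rw [hF] at hu ⊢
      intro n
      have h := hu ⟨w⁻¹ * n * w, by simpa using hN.conj_mem n n.2 w⁻¹⟩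
      rw [← geometricRep_mul_apply]
      have e : (n : W) * w = w * (w⁻¹ * n * w) := by group
      rw [e, geometricRep_mul_apply]
      exact congrArg _ h
    · intro hrad
      obtain ⟨i⟩ := hirr.nonempty
      have h1 := hrad (P (simpleRoot i)) ((hF _).2 fun n => hnP n _) i
      have h2 (n : N) : simpleCoroot M i (geometricRep cs n (simpleRoot i)) = 2 := by
        have := hker (simpleRoot i - geometricRep cs n (simpleRoot i))
          (by rw [map_sub, hPn, sub_self]) i
        rw [map_sub, simpleCoroot_simpleRoot_self] at this
        linarith
      rw [hP, map_sum, Finset.sum_congr rfl fun n _ => h2 n] at h1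
      simp at h1
  rw [eq_bot_iff]
  intro n hn
  rw [Subgroup.mem_bot]
  exact eq_one_of_geometricRep_simpleRoot cs fun i =>
    (hF _).1 (hFtop ▸ Submodule.mem_top) ⟨n, hn⟩

end GeometricRepresentation

/-- If an irreducible Coxeter group `W` contains an infinite cyclic
subgroup `⟨x⟩` of finite index, then `W` is isomorphic to the infinite dihedral
group `D_∞`. -/
theorem isomorphic_to_infinite_dihedral_of_infinite_cyclic_finiteIndex
    {B W : Type*} [Fintype B] [Group W] {M : CoxeterMatrix B} (cs : CoxeterSystem M W)
    (hirr : IsIrreducible M)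
    (x : W) (hx : ¬ IsOfFinOrder x) (hidx : (Subgroup.zpowers x).FiniteIndex) :
    Nonempty (W ≃* DInfty) := by
  have : Infinite W :=
    Infinite.of_injective (fun k : ℤ => x ^ k) (injective_zpow_iff_not_isOfFinOrder.2 hx)
  refine nonempty_mulEquiv_DInfty_of_no_finite_normal ?_
    (eq_bot_of_normal_of_finite cs hirr) x hx
  rw [eq_top_iff, ← cs.subgroup_closure_range_simple]
  refine Subgroup.closure_mono ?_
  rintro _ ⟨i, rfl⟩
  exact cs.simple_mul_simple_self i

end CoxeterPaper
end

section
/- Let W = W_1 × W_2, where W_1 and W_2 are irreducible, infinite, non-affine Coxeter groups of finite rank. If H is a finite index subgroup of W and H = H_1 × H_2 is an internal direct product with H_1 ≠ {1} and H_2 ≠ {1}, then after possibly swapping the indices, H_1 ⊆ W_1 and H_2 ⊆ W_2. -/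
namespace CoxeterPaper

/-- The entry `-cos (π / m i j)` of the matrix of the standard bilinear form,
interpreted as `-1` when `m i j = ∞` (encoded as `0`). -/
noncomputable def formEntry {B : Type*} (M : CoxeterMatrix B) (i j : B) : ℝ :=
  if M i j = 0 then -1 else - Real.cos (Real.pi / (M i j : ℝ))

/-- The standard bilinear form associated to a Coxeter matrix, on `V = B → ℝ`
(with basis `{α_s : s ∈ S}` identified with the standard basis). -/
noncomputable def bilin {B : Type*} [Fintype B] (M : CoxeterMatrix B) (v w : B → ℝ) : ℝ :=
  ∑ i, ∑ j, v i * w j * formEntry M i j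

/-- The standard bilinear form is positive definite. -/
def IsPosDef {B : Type*} [Fintype B] (M : CoxeterMatrix B) : Prop :=
  ∀ v : B → ℝ, v ≠ 0 → 0 < bilin M v v

/-- The standard bilinear form is positive semidefinite. -/
def IsPosSemidef {B : Type*} [Fintype B] (M : CoxeterMatrix B) : Prop :=
  ∀ v : B → ℝ, 0 ≤ bilin M v v

section Entries

variable {B : Type*} (M : CoxeterMatrix B)

lemma formEntry_symm (i j : B) : formEntry M i j = formEntry M j i := by
  simp only [formEntry, M.symmetric i j]

lemma formEntry_self (i : B) : formEntry M i i = 1 := by simp [formEntry]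

lemma two_le_of_ne {s t : B} (h : s ≠ t) (h0 : M s t ≠ 0) : 2 ≤ M s t := by
  have := M.off_diagonal s t h
  omega

lemma formEntry_nonpos {s t : B} (h : s ≠ t) : formEntry M s t ≤ 0 := by
  unfold formEntry
  split_ifs with h0
  · norm_num
  · have h2 : (2 : ℝ) ≤ M s t := by exact_mod_cast two_le_of_ne M h h0
    have := Real.pi_pos
    rw [neg_nonpos]
    apply Real.cos_nonneg_of_mem_Icc
    constructor
    · have : 0 ≤ Real.pi / (M s t : ℝ) := by positivity
      linarith
    · exact div_le_div_of_nonneg_left this.le (by norm_num) h2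

lemma neg_one_le_formEntry (s t : B) : -1 ≤ formEntry M s t := by
  unfold formEntry
  split_ifs with h0
  · norm_num
  · linarith [Real.cos_le_one (Real.pi / (M s t : ℝ))]

lemma formEntry_ne_zero_of_adj {s t : B} (h : (coxeterGraph M).Adj s t) :
    formEntry M s t < 0 := by
  rw [coxeterGraph, SimpleGraph.fromRel_adj] at h
  have hne := h.1
  have h2 : M s t ≠ 2 := by
    rcases h.2 with h | h
    · exact h
    · rwa [M.symmetric]
  unfold formEntry
  split_ifs with h0
  · norm_num
  · have h3 : (2 : ℝ) < M s t := by
      have := two_le_of_ne M hne h0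
      exact_mod_cast lt_of_le_of_ne this (Ne.symm h2)
    have := Real.pi_pos
    rw [neg_lt_zero]
    apply Real.cos_pos_of_mem_Ioo
    constructor
    · have : 0 ≤ Real.pi / (M s t : ℝ) := by positivity
      linarith
    · exact div_lt_div_of_pos_left this (by norm_num) h3

lemma sin_pi_div_pos {s t : B} (h : s ≠ t) (h0 : M s t ≠ 0) :
    0 < Real.sin (Real.pi / (M s t : ℝ)) := by
  have h2 : (2 : ℝ) ≤ M s t := by exact_mod_cast two_le_of_ne M h h0
  have := Real.pi_pos
  apply Real.sin_pos_of_pos_of_lt_pi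
  · positivity
  · exact div_lt_self this (by linarith)

open Classical in
/-- The simple root `α_s`. -/
noncomputable def sroot (s : B) : B → ℝ := Pi.single s 1

lemma sroot_self (s : B) : sroot s s = 1 := by simp [sroot]

lemma sroot_of_ne {s t : B} (h : t ≠ s) : sroot s t = 0 := by simp [sroot, h]

lemma sroot_nonneg (s : B) : 0 ≤ (sroot s : B → ℝ) := by
  classical
  simp [sroot]

end Entries

section Form

variable {B : Type*} [Fintype B] (M : CoxeterMatrix B)

/-- The standard form as a bilinear form in the sense of Mathlib. -/
noncomputable def form : LinearMap.BilinForm ℝ (B → ℝ) :=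
  LinearMap.mk₂ ℝ (bilin M)
    (fun x y z => by
      simp only [bilin, ← Finset.sum_add_distrib, Pi.add_apply, add_mul])
    (fun c x y => by
      simp only [bilin, Finset.mul_sum, Pi.smul_apply, smul_eq_mul, mul_assoc])
    (fun x y z => by
      simp only [bilin, ← Finset.sum_add_distrib, Pi.add_apply, add_mul, mul_add])
    (fun c x y => by
      simp only [bilin, Finset.mul_sum, Pi.smul_apply, smul_eq_mul, mul_assoc, mul_left_comm])

lemma form_apply (v w : B → ℝ) : form M v w = bilin M v w := rfl

lemma form_symm (v w : B → ℝ) : form M v w = form M w v := by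
  simp only [form_apply, bilin]
  rw [Finset.sum_comm]
  refine Finset.sum_congr rfl fun i _ => Finset.sum_congr rfl fun j _ => ?_
  rw [formEntry_symm M j i]
  ring

lemma eq_sum_sroot (v : B → ℝ) : v = ∑ s, v s • sroot s := by
  classical
  ext t
  simp [Finset.sum_apply, sroot, Pi.single_apply]

lemma form_sroot_sroot (s t : B) : form M (sroot s) (sroot t) = formEntry M s t := by
  classical
  simp only [form_apply, bilin, sroot]
  rw [Finset.sum_eq_single s, Finset.sum_eq_single t] <;>
    simp +contextual [Pi.single_apply]

lemma form_sroot_self (s : B) : form M (sroot s) (sroot s) = 1 := by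
  rw [form_sroot_sroot, formEntry_self]

/-- The orthogonal reflection in a vector `a`, meaningful when `(a, a) = 1`. -/
noncomputable def refl (a : B → ℝ) : Module.End ℝ (B → ℝ) :=
  LinearMap.id - ((2 : ℝ) • (form M).flip a).smulRight a

lemma refl_apply (a v : B → ℝ) : refl M a v = v - (2 * form M v a) • a := by
  simp [refl]

lemma refl_self {a : B → ℝ} (h : form M a a = 1) : refl M a a = -a := by
  rw [refl_apply, h, mul_one, two_smul]; abel

lemma refl_refl {a : B → ℝ} (h : form M a a = 1) (v : B → ℝ) : refl M a (refl M a v) = v := by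
  rw [refl_apply M a v, map_sub, map_smul, refl_self M h, refl_apply]
  module

lemma form_refl_refl {a : B → ℝ} (h : form M a a = 1) (v w : B → ℝ) :
    form M (refl M a v) (refl M a w) = form M v w := by
  simp only [refl_apply, map_sub, map_smul, LinearMap.sub_apply, LinearMap.smul_apply, h,
    smul_eq_mul, form_symm M a w]
  ring

end Form

section Dihedral

/-- The Chebyshev-like coefficients describing the roots of a dihedral group. -/
noncomputable def dihCoeff (q : ℝ) : ℕ → ℝ
  | 0 => 0
  | 1 => 1
  | (k + 2) => 2 * q * dihCoeff q (k + 1) - dihCoeff q k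

lemma dihCoeff_one (k : ℕ) : dihCoeff 1 k = k := by
  induction k using Nat.twoStepInduction with
  | zero => simp [dihCoeff]
  | one => simp [dihCoeff]
  | more k h1 h2 => rw [dihCoeff, h1, h2]; push_cast; ring

lemma sin_mul_dihCoeff (θ : ℝ) (k : ℕ) :
    Real.sin θ * dihCoeff (Real.cos θ) k = Real.sin (k * θ) := by
  induction k using Nat.twoStepInduction with
  | zero => simp [dihCoeff]
  | one => simp [dihCoeff]
  | more k h1 h2 =>
    rw [dihCoeff, mul_sub, h1]
    have : Real.sin θ * (2 * Real.cos θ * dihCoeff (Real.cos θ) (k + 1)) =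
      2 * Real.cos θ * (Real.sin θ * dihCoeff (Real.cos θ) (k + 1)) := by ring
    rw [this, h2]
    have e1 : ((k + 2 : ℕ) : ℝ) * θ = ((k + 1 : ℕ) : ℝ) * θ + θ := by push_cast; ring
    have e2 : (k : ℝ) * θ = ((k + 1 : ℕ) : ℝ) * θ - θ := by push_cast; ring
    rw [e1, e2, Real.sin_add, Real.sin_sub]
    ring

variable {B : Type*} (M : CoxeterMatrix B)

lemma dihCoeff_nonneg {s t : B} (h : s ≠ t) {k : ℕ} (hk : M s t = 0 ∨ k ≤ M s t) :
    0 ≤ dihCoeff (-formEntry M s t) k := by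
  by_cases h0 : M s t = 0
  · simp [formEntry, h0, dihCoeff_one]
  · have hk := hk.resolve_left h0
    simp only [formEntry, h0, if_false, neg_neg]
    have hs := sin_pi_div_pos M h h0
    have h2 := sin_mul_dihCoeff (Real.pi / (M s t : ℝ)) k
    have hM : (0 : ℝ) < M s t := by exact_mod_cast Nat.pos_of_ne_zero h0
    have : 0 ≤ Real.sin (k * (Real.pi / (M s t : ℝ))) := by
      apply Real.sin_nonneg_of_nonneg_of_le_pi
      · have := Real.pi_pos; positivity
      · have : (k : ℝ) ≤ M s t := by exact_mod_cast hk
        calc (k : ℝ) * (Real.pi / (M s t : ℝ)) ≤ M s t * (Real.pi / (M s t : ℝ)) := by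
              have := Real.pi_pos; gcongr
          _ = Real.pi := by field_simp
    rw [← h2] at this
    exact nonneg_of_mul_nonneg_right this hs

lemma dihCoeff_two_mul {s t : B} (h : s ≠ t) (h0 : M s t ≠ 0) :
    dihCoeff (-formEntry M s t) (2 * M s t) = 0 ∧
      dihCoeff (-formEntry M s t) (2 * M s t + 1) = 1 := by
  have hs := sin_pi_div_pos M h h0
  simp only [formEntry, h0, if_false, neg_neg]
  have hM : (M s t : ℝ) ≠ 0 := by exact_mod_cast h0
  have e : (M s t : ℝ) * (Real.pi / (M s t : ℝ)) = Real.pi := by field_simp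
  constructor
  · have h2 := sin_mul_dihCoeff (Real.pi / (M s t : ℝ)) (2 * M s t)
    push_cast at h2
    rw [mul_assoc, e, Real.sin_two_pi] at h2
    exact (mul_eq_zero.mp h2).resolve_left hs.ne'
  · have h2 := sin_mul_dihCoeff (Real.pi / (M s t : ℝ)) (2 * M s t + 1)
    push_cast at h2
    rw [add_mul, mul_assoc, e, one_mul, add_comm (2 * Real.pi), Real.sin_add_two_pi] at h2
    exact mul_left_cancel₀ hs.ne' (by rw [h2, mul_one])

variable [Fintype B]

lemma refl_sroot_of_ne (s t : B) :
    refl M (sroot s) (sroot t) = sroot t + (2 * -formEntry M s t) • sroot s := by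
  rw [refl_apply, form_sroot_sroot, formEntry_symm M t s]
  module

lemma refl_mul_refl_pow_sroot_left (s t : B) (k : ℕ) :
    ((refl M (sroot s) * refl M (sroot t)) ^ k) (sroot s) =
      dihCoeff (-formEntry M s t) (2 * k + 1) • sroot s +
        dihCoeff (-formEntry M s t) (2 * k) • sroot t := by
  induction k with
  | zero => simp [dihCoeff]
  | succ k ih =>
    rw [pow_succ', Module.End.mul_apply, ih, Module.End.mul_apply]
    simp only [map_add, map_smul, refl_sroot_of_ne, refl_self M (form_sroot_self M _),
      formEntry_symm M t s, map_neg, Nat.mul_succ]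
    have e1 : dihCoeff (-formEntry M s t) (2 * k + 2 + 1) = 2 * (-formEntry M s t) *
      dihCoeff (-formEntry M s t) (2 * k + 2) - dihCoeff (-formEntry M s t) (2 * k + 1) := rfl
    have e2 : dihCoeff (-formEntry M s t) (2 * k + 2) = 2 * (-formEntry M s t) *
      dihCoeff (-formEntry M s t) (2 * k + 1) - dihCoeff (-formEntry M s t) (2 * k) := rfl
    rw [e1, e2]
    module

lemma refl_mul_refl_pow_sroot_right {s t : B} (h : s ≠ t) (h0 : M s t ≠ 0) :
    ((refl M (sroot s) * refl M (sroot t)) ^ M s t) (sroot t) = sroot t := by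
  have hs : refl M (sroot s) * refl M (sroot s) = 1 :=
    LinearMap.ext fun v => refl_refl M (form_sroot_self M s) v
  have ht : refl M (sroot t) * refl M (sroot t) = 1 :=
    LinearMap.ext fun v => refl_refl M (form_sroot_self M t) v
  have h1 : (refl M (sroot s) * refl M (sroot t)) * (refl M (sroot t) * refl M (sroot s)) = 1 := by
    rw [mul_assoc, ← mul_assoc (refl M (sroot t)), ht, one_mul, hs]
  have h2 : (refl M (sroot t) * refl M (sroot s)) * (refl M (sroot s) * refl M (sroot t)) = 1 := by
    rw [mul_assoc, ← mul_assoc (refl M (sroot s)), hs, one_mul, ht]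
  have hcomm : (refl M (sroot s) * refl M (sroot t)) ^ M s t *
      (refl M (sroot t) * refl M (sroot s)) ^ M s t = 1 := by
    rw [← Commute.mul_pow (h1.trans h2.symm), h1, one_pow]
  have key := refl_mul_refl_pow_sroot_left M t s (M s t)
  rw [formEntry_symm M t s] at key
  obtain ⟨e1, e2⟩ := dihCoeff_two_mul M h h0
  rw [e1, e2, zero_smul, one_smul, add_zero] at key
  calc _ = ((refl M (sroot s) * refl M (sroot t)) ^ M s t)
        (((refl M (sroot t) * refl M (sroot s)) ^ M s t) (sroot t)) := by rw [key]
    _ = sroot t := by rw [← Module.End.mul_apply, hcomm]; rfl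

lemma refl_isLiftable : M.IsLiftable fun s => refl M (sroot s) := by
  intro s t
  by_cases h : s = t
  · subst h
    rw [M.diagonal, pow_one]
    exact LinearMap.ext fun v => refl_refl M (form_sroot_self M s) v
  by_cases h0 : M s t = 0
  · rw [h0, pow_zero]
  set b := formEntry M s t with hb
  have hb1 : b ^ 2 ≠ 1 := by
    rw [hb, formEntry, if_neg h0]
    have := sin_pi_div_pos M h h0
    have := Real.sin_sq_add_cos_sq (Real.pi / (M s t : ℝ))
    intro h'
    rw [neg_sq] at h'
    nlinarith
  have hleft := refl_mul_refl_pow_sroot_left M s t (M s t)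
  obtain ⟨e1, e2⟩ := dihCoeff_two_mul M h h0
  rw [e1, e2, zero_smul, one_smul, add_zero] at hleft
  have hright := refl_mul_refl_pow_sroot_right M h h0
  have hb2 : 1 - b ^ 2 ≠ 0 := fun h' => hb1 (by linarith)
  refine LinearMap.ext fun v => ?_
  have hfix : ∀ z : B → ℝ, form M z (sroot s) = 0 → form M z (sroot t) = 0 →
      ((refl M (sroot s) * refl M (sroot t)) ^ M s t) z = z := by
    intro z hz1 hz2
    rw [Module.End.pow_apply]
    apply Function.iterate_fixed
    simp [refl_apply, hz1, hz2]
  set p := form M v (sroot s)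
  set r := form M v (sroot t)
  set x := (p - b * r) / (1 - b ^ 2) with hx
  set y := (r - b * p) / (1 - b ^ 2) with hy
  have hz := hfix (v - (x • sroot s + y • sroot t))
    (by
      simp only [map_sub, map_add, map_smul, LinearMap.sub_apply, LinearMap.add_apply,
        LinearMap.smul_apply, form_sroot_sroot, formEntry_self, smul_eq_mul, formEntry_symm M t s]
      rw [← hb, hx, hy]
      field_simp
      ring)
    (by
      simp only [map_sub, map_add, map_smul, LinearMap.sub_apply, LinearMap.add_apply,
        LinearMap.smul_apply, form_sroot_sroot, formEntry_self, smul_eq_mul]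
      rw [← hb, hx, hy]
      field_simp
      ring)
  rw [map_sub, map_add, map_smul, map_smul, hleft, hright] at hz
  exact sub_left_injective hz

end Dihedral

section Representation

/-- The key step of root positivity: splitting off a maximal alternating suffix. -/
lemma exists_maximal_alternating {B W : Type*} [Group W] {M : CoxeterMatrix B}
    (cs : CoxeterSystem M W) {w : W} {s t : B}
    (hs : cs.length w < cs.length (w * cs.simple s))
    (ht : cs.length (w * cs.simple t) < cs.length w) :
    ∃ (w' : W) (k : ℕ), w = w' * cs.wordProd (CoxeterSystem.alternatingWord s t k) ∧
      cs.length w' < cs.length w ∧ (M s t = 0 ∨ k + 1 ≤ M s t) ∧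
      cs.length w' < cs.length (w' * cs.simple s) ∧
      cs.length w' < cs.length (w' * cs.simple t) := by
  classical
  let P : ℕ → Prop := fun k => ∃ w', w * cs.simple s =
    w' * cs.wordProd (CoxeterSystem.alternatingWord t s k) ∧
      cs.length (w * cs.simple s) = cs.length w' + k
  have hls : cs.length (w * cs.simple s) = cs.length w + 1 := by
    rcases cs.length_mul_simple w s with h | h <;> omega
  have hlt : cs.length (w * cs.simple t) + 1 = cs.length w := by
    rcases cs.length_mul_simple w t with h | h <;> omega
  have hP2 : P 2 := by
    refine ⟨w * cs.simple t, ?_, by omega⟩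
    simp [CoxeterSystem.alternatingWord, cs.wordProd_cons, ← mul_assoc]
  have h2 : 2 ≤ cs.length (w * cs.simple s) := by omega
  set n := Nat.findGreatest P (cs.length (w * cs.simple s)) with hn
  have hPn : P n := Nat.findGreatest_spec h2 hP2
  have hn2 : 2 ≤ n := Nat.le_findGreatest h2 hP2
  have hnP : ¬ P (n + 1) := by
    intro h
    have hle : n + 1 ≤ cs.length (w * cs.simple s) := by
      obtain ⟨w', -, h'⟩ := h
      omega
    have := Nat.le_findGreatest hle h
    omega
  obtain ⟨w', hw', hl⟩ := hPn
  obtain ⟨k, hk⟩ : ∃ k, n = k + 1 := ⟨n - 1, by omega⟩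
  have hA : cs.length w' < cs.length (w' * cs.simple (if Even n then s else t)) := by
    by_contra hcon
    apply hnP
    refine ⟨w' * cs.simple (if Even n then s else t), ?_, ?_⟩
    · rw [hw', CoxeterSystem.alternatingWord_succ', cs.wordProd_cons, ← mul_assoc,
        cs.simple_mul_simple_cancel_right]
    · rcases cs.length_mul_simple w' (if Even n then s else t) with h | h <;> omega
  have hB : cs.length w' < cs.length (w' * cs.simple (if Even k then s else t)) := by
    by_contra hcon
    have h1 : cs.length (w' * cs.simple (if Even k then s else t)) + 1 = cs.length w' := by
      rcases cs.length_mul_simple w' (if Even k then s else t) with h | h <;> omega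
    have h2 := cs.length_mul_le (w' * cs.simple (if Even k then s else t))
      (cs.wordProd (CoxeterSystem.alternatingWord t s k))
    have h3 := cs.length_wordProd_le (CoxeterSystem.alternatingWord t s k)
    rw [mul_assoc, ← cs.wordProd_cons, ← CoxeterSystem.alternatingWord_succ', ← hk, ← hw'] at h2
    rw [CoxeterSystem.length_alternatingWord] at h3
    omega
  have hred : M t s = 0 ∨ n ≤ M t s := by
    by_contra! hcon
    apply cs.not_isReduced_alternatingWord t s hcon.1 hcon.2
    have h2 := cs.length_mul_le w' (cs.wordProd (CoxeterSystem.alternatingWord t s n))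
    have h3 := cs.length_wordProd_le (CoxeterSystem.alternatingWord t s n)
    rw [← hw'] at h2
    rw [CoxeterSystem.IsReduced]
    rw [CoxeterSystem.length_alternatingWord] at h3 ⊢
    omega
  refine ⟨w', k, ?_, by omega, ?_, ?_⟩
  · rw [hk, CoxeterSystem.alternatingWord_succ, cs.wordProd_concat, ← mul_assoc] at hw'
    exact mul_right_cancel hw'
  · rwa [M.symmetric s t, ← hk]
  · by_cases hke : Even k
    · have : ¬ Even n := by grind
      rw [if_neg this] at hA
      rw [if_pos hke] at hB
      exact ⟨hB, hA⟩
    · have : Even n := by grind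
      rw [if_pos this] at hA
      rw [if_neg hke] at hB
      exact ⟨hA, hB⟩

variable {B W : Type*} [Fintype B] [Group W] {M : CoxeterMatrix B} (cs : CoxeterSystem M W)

/-- The geometric representation of a Coxeter group. -/
noncomputable def rho : W →* Module.End ℝ (B → ℝ) :=
  cs.lift ⟨fun s => refl M (sroot s), refl_isLiftable M⟩

lemma rho_simple (s : B) : rho cs (cs.simple s) = refl M (sroot s) :=
  cs.lift_apply_simple (refl_isLiftable M) s

lemma rho_mul_apply (w x : W) (v : B → ℝ) : rho cs (w * x) v = rho cs w (rho cs x v) := by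
  rw [map_mul, Module.End.mul_apply]

lemma rho_one_apply (v : B → ℝ) : rho cs 1 v = v := by
  rw [map_one, Module.End.one_apply]

lemma rho_inv_rho (w : W) (v : B → ℝ) : rho cs w⁻¹ (rho cs w v) = v := by
  rw [← rho_mul_apply, inv_mul_cancel, rho_one_apply]

lemma rho_rho_inv (w : W) (v : B → ℝ) : rho cs w (rho cs w⁻¹ v) = v := by
  rw [← rho_mul_apply, mul_inv_cancel, rho_one_apply]

lemma rho_simple_sroot_self (s : B) : rho cs (cs.simple s) (sroot s) = -sroot s := by
  rw [rho_simple, refl_self M (form_sroot_self M s)]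

lemma form_rho (w : W) (v u : B → ℝ) : form M (rho cs w v) (rho cs w u) = form M v u := by
  induction w using cs.simple_induction_left with
  | one => simp only [rho_one_apply]
  | mul_simple_left w s ih =>
    rw [rho_mul_apply, rho_mul_apply, rho_simple, form_refl_refl M (form_sroot_self M s), ih]

lemma form_rho_left (w : W) (v u : B → ℝ) : form M (rho cs w v) u = form M v (rho cs w⁻¹ u) := by
  rw [← form_rho cs w v, rho_rho_inv]

lemma rho_alternatingWord_sroot (s t : B) (m : ℕ) :
    rho cs (cs.wordProd (CoxeterSystem.alternatingWord s t m)) (sroot s) =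
      if Even m then dihCoeff (-formEntry M s t) (m + 1) • sroot s +
        dihCoeff (-formEntry M s t) m • sroot t
      else dihCoeff (-formEntry M s t) m • sroot s +
        dihCoeff (-formEntry M s t) (m + 1) • sroot t := by
  induction m with
  | zero => simp [CoxeterSystem.alternatingWord, dihCoeff]
  | succ m ih =>
    rw [CoxeterSystem.alternatingWord_succ', cs.wordProd_cons, rho_mul_apply, ih, rho_simple]
    have e : dihCoeff (-formEntry M s t) (m + 1 + 1) = 2 * (-formEntry M s t) *
      dihCoeff (-formEntry M s t) (m + 1) - dihCoeff (-formEntry M s t) m := rfl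
    by_cases hm : Even m
    · have hm' : ¬ Even (m + 1) := by grind
      simp only [hm, hm', if_true, if_false, map_add, map_smul, refl_sroot_of_ne,
        refl_self M (form_sroot_self M _), formEntry_symm M t s, e]
      module
    · have hm' : Even (m + 1) := by grind
      simp only [hm, hm', if_true, if_false, map_add, map_smul, refl_sroot_of_ne,
        refl_self M (form_sroot_self M _), e]
      module

theorem rho_sroot_nonneg (w : W) (s : B) (h : cs.length w < cs.length (w * cs.simple s)) :
    0 ≤ rho cs w (sroot s) := by
  induction hn : cs.length w using Nat.strong_induction_on generalizing w s with
  | _ n ih =>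
  subst hn
  by_cases hw : w = 1
  · rw [hw, rho_one_apply]
    exact sroot_nonneg s
  obtain ⟨t, ht⟩ := cs.exists_rightDescent_of_ne_one hw
  have hst : s ≠ t := by
    rintro rfl
    exact lt_asymm h ht
  obtain ⟨w', k, e, hl, hk, hs', ht'⟩ := exists_maximal_alternating cs h ht
  have h1 := ih _ hl w' s hs' rfl
  have h2 := ih _ hl w' t ht' rfl
  have c1 := dihCoeff_nonneg M hst hk
  have c2 := dihCoeff_nonneg M hst (hk.imp_right (Nat.le_of_succ_le))
  rw [e, rho_mul_apply, rho_alternatingWord_sroot]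
  split_ifs <;> rw [map_add, map_smul, map_smul] <;>
    exact add_nonneg (smul_nonneg (by assumption) h1) (smul_nonneg (by assumption) h2)

theorem rho_sroot_nonpos (w : W) (s : B) (h : cs.length (w * cs.simple s) < cs.length w) :
    rho cs w (sroot s) ≤ 0 := by
  have := rho_sroot_nonneg cs (w * cs.simple s) s (by rwa [cs.simple_mul_simple_cancel_right])
  rw [rho_mul_apply, rho_simple_sroot_self, map_neg] at this
  exact neg_nonneg.mp this

/-- The predicate of being a root. -/
def IsRoot (β : B → ℝ) : Prop := ∃ w s, β = rho cs w (sroot s)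

lemma isRoot_sroot (s : B) : IsRoot cs (sroot s) := ⟨1, s, (rho_one_apply cs _).symm⟩

variable {cs}

lemma IsRoot.rho {β : B → ℝ} (h : IsRoot cs β) (w : W) : IsRoot cs (rho cs w β) := by
  obtain ⟨x, s, rfl⟩ := h
  exact ⟨w * x, s, (rho_mul_apply cs w x _).symm⟩

lemma IsRoot.neg {β : B → ℝ} (h : IsRoot cs β) : IsRoot cs (-β) := by
  obtain ⟨x, s, rfl⟩ := h
  exact ⟨x * cs.simple s, s, by rw [rho_mul_apply, rho_simple_sroot_self, map_neg]⟩

lemma IsRoot.form_self {β : B → ℝ} (h : IsRoot cs β) : form M β β = 1 := by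
  obtain ⟨x, s, rfl⟩ := h
  rw [form_rho, form_sroot_self]

lemma IsRoot.ne_zero {β : B → ℝ} (h : IsRoot cs β) : β ≠ 0 := by
  rintro rfl
  simpa using h.form_self

lemma IsRoot.nonneg_or_nonpos {β : B → ℝ} (h : IsRoot cs β) : 0 ≤ β ∨ β ≤ 0 := by
  obtain ⟨w, s, rfl⟩ := h
  rcases cs.length_mul_simple w s with h | h
  · exact .inl (rho_sroot_nonneg cs w s (by omega))
  · exact .inr (rho_sroot_nonpos cs w s (by omega))

lemma IsRoot.not_nonneg_nonpos {β : B → ℝ} (h : IsRoot cs β) (h1 : 0 ≤ β) (h2 : β ≤ 0) : False :=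
  h.ne_zero (le_antisymm h2 h1)

lemma IsRoot.not_nonpos_iff {β : B → ℝ} (h : IsRoot cs β) : ¬ β ≤ 0 ↔ 0 ≤ β :=
  ⟨h.nonneg_or_nonpos.resolve_right, fun h1 h2 => h.not_nonneg_nonpos h1 h2⟩

/-- A simple reflection permutes the positive roots other than its own simple root. -/
lemma IsRoot.rho_simple_nonneg {β : B → ℝ} (h : IsRoot cs β) (h0 : 0 ≤ β) (s : B)
    (hne : β ≠ sroot s) : 0 ≤ CoxeterPaper.rho cs (cs.simple s) β := by
  rw [← (h.rho _).not_nonpos_iff]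
  intro hneg
  have hz : ∀ t, t ≠ s → β t = 0 := by
    intro t ht
    have h1 := hneg t
    rw [rho_simple, refl_apply, Pi.sub_apply, Pi.smul_apply, sroot_of_ne ht] at h1
    simp only [smul_zero, sub_zero, Pi.zero_apply] at h1
    exact le_antisymm h1 (h0 t)
  have hβ : β = β s • sroot s := by
    ext t
    by_cases ht : t = s
    · subst ht
      simp [sroot_self]
    · simp [sroot_of_ne ht, hz t ht]
  have h1 := h.form_self
  rw [hβ] at h1
  simp only [map_smul, LinearMap.smul_apply, form_sroot_self, smul_eq_mul, mul_one] at h1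
  have h2 : β s = 1 := by
    have := h0 s
    simp only [Pi.zero_apply] at this
    nlinarith
  rw [h2, one_smul] at hβ
  exact hne hβ

variable (cs)

/-- The positive roots made negative by `w` form a finite set. -/
lemma finite_inversions (w : W) : {β | IsRoot cs β ∧ 0 ≤ β ∧ rho cs w β ≤ 0}.Finite := by
  induction w using cs.simple_induction_right with
  | one =>
    convert Set.finite_empty
    ext β
    simp only [rho_one_apply, Set.mem_ofPred_eq, Set.mem_empty_iff_false, iff_false]
    rintro ⟨h, h1, h2⟩
    exact h.not_nonneg_nonpos h1 h2
  | mul_simple_right w s ih =>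
    refine ((ih.image (rho cs (cs.simple s))).insert (sroot s)).subset ?_
    rintro β ⟨h, h1, h2⟩
    by_cases hβ : β = sroot s
    · exact .inl hβ
    · refine .inr ⟨rho cs (cs.simple s) β, ⟨h.rho _, h.rho_simple_nonneg h1 s hβ, ?_⟩, ?_⟩
      · rwa [← rho_mul_apply]
      · rw [← rho_mul_apply, cs.simple_mul_simple_self, rho_one_apply]

end Representation

section PerronFrobenius

variable {B : Type*} {M : CoxeterMatrix B}

lemma IsIrreducible.induction (h : IsIrreducible M) {P : B → Prop}
    (hP : ∀ s t, (coxeterGraph M).Adj s t → P s → P t) {s : B} (hs : P s) (t : B) : P t := by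
  obtain ⟨p⟩ := SimpleGraph.Connected.preconnected h s t
  induction p with
  | nil => exact hs
  | cons hadj _ ih => exact ih (hP _ _ hadj hs)

variable [Fintype B]

lemma form_sroot_right (v : B → ℝ) (s : B) :
    form M v (sroot s) = ∑ t, v t * formEntry M t s := by
  conv_lhs => rw [eq_sum_sroot v]
  simp [form_sroot_sroot]

lemma form_eq_sum (v u : B → ℝ) : form M v u = ∑ s, u s * form M v (sroot s) := by
  conv_lhs => rw [eq_sum_sroot u]
  simp

lemma dotProduct_sroot (v : B → ℝ) (s : B) : v ⬝ᵥ sroot s = v s := by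
  classical
  simp [sroot]

lemma form_abs_le (v : B → ℝ) : form M |v| |v| ≤ form M v v := by
  simp only [form_apply, bilin]
  refine Finset.sum_le_sum fun i _ => Finset.sum_le_sum fun j _ => ?_
  rw [Pi.abs_apply, Pi.abs_apply, ← abs_mul]
  by_cases h : i = j
  · subst h
    rw [abs_of_nonneg (mul_self_nonneg _)]
  · exact mul_le_mul_of_nonpos_right (le_abs_self _) (formEntry_nonpos M h)

lemma exists_min_form (h : ¬ IsPosSemidef M) : ∃ (c : ℝ) (v : B → ℝ), c < 0 ∧ 0 ≤ v ∧
    v ⬝ᵥ v = 1 ∧ form M v v = c ∧ ∀ u, c * (u ⬝ᵥ u) ≤ form M u u := by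
  have hnn : ∀ u : B → ℝ, 0 ≤ u ⬝ᵥ u := fun u =>
    Finset.sum_nonneg fun i _ => mul_self_nonneg _
  have habs : ∀ u : B → ℝ, |u| ⬝ᵥ |u| = u ⬝ᵥ u := fun u => by simp [dotProduct]
  let K : Set (B → ℝ) := {u | u ⬝ᵥ u = 1} ∩ Set.Icc 0 1
  have hK : IsCompact K := by
    refine isCompact_Icc.inter_left (isClosed_eq ?_ continuous_const)
    simp only [dotProduct]
    fun_prop
  have hmem : ∀ u : B → ℝ, u ≠ 0 → (Real.sqrt (u ⬝ᵥ u))⁻¹ • |u| ∈ K := by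
    intro u hu
    have hpos : 0 < u ⬝ᵥ u := lt_of_le_of_ne (hnn u) fun h0 =>
      hu (dotProduct_self_eq_zero.mp h0.symm)
    have hs := Real.sqrt_pos.mpr hpos
    refine ⟨?_, ?_, ?_⟩
    · simp only [Set.mem_ofPred_eq, smul_dotProduct, dotProduct_smul, habs, smul_eq_mul]
      have := Real.mul_self_sqrt hpos.le
      field_simp
      nlinarith
    · exact smul_nonneg (inv_nonneg.mpr hs.le) (abs_nonneg u)
    · intro i
      simp only [Pi.smul_apply, Pi.abs_apply, smul_eq_mul, Pi.one_apply]
      rw [inv_mul_le_iff₀ hs, mul_one]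
      apply Real.abs_le_sqrt
      rw [sq]
      exact Finset.single_le_sum (f := fun i => u i * u i) (fun i _ => mul_self_nonneg _)
        (Finset.mem_univ i)
  obtain ⟨x, hx⟩ : ∃ x, form M x x < 0 := by
    simpa only [IsPosSemidef, not_forall, not_le, form_apply] using h
  have hx0 : x ≠ 0 := by
    rintro rfl
    simp at hx
  have hcont : Continuous fun u : B → ℝ => form M u u := by
    simp only [form_apply, bilin]
    fun_prop
  obtain ⟨v, hv, hmin⟩ := hK.exists_isMinOn ⟨_, hmem x hx0⟩ hcont.continuousOn
  have hle : ∀ u, form M v v * (u ⬝ᵥ u) ≤ form M u u := by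
    intro u
    by_cases hu : u = 0
    · simp [hu]
    have hpos : 0 < u ⬝ᵥ u := lt_of_le_of_ne (hnn u) fun h0 =>
      hu (dotProduct_self_eq_zero.mp h0.symm)
    have h1 := hmin (hmem u hu)
    simp only [Set.mem_ofPred_eq, map_smul, LinearMap.smul_apply, smul_eq_mul] at h1
    have h2 := form_abs_le (M := M) u
    have h3 := Real.mul_self_sqrt hpos.le
    have hs := Real.sqrt_pos.mpr hpos
    rw [← mul_assoc, ← mul_inv, h3, le_inv_mul_iff₀ hpos] at h1
    linarith
  refine ⟨form M v v, v, ?_, hv.2.1, hv.1, rfl, hle⟩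
  have := hle x
  have hpos : 0 < x ⬝ᵥ x := lt_of_le_of_ne (hnn x) fun h0 =>
    hx0 (dotProduct_self_eq_zero.mp h0.symm)
  by_contra! hcon
  nlinarith [mul_nonneg hcon hpos.le]

/-- A vector in the interior of the positive cone pairing negatively with all simple roots. -/
structure IsNegVector (M : CoxeterMatrix B) (v : B → ℝ) : Prop where
  pos : ∀ s, 0 < v s
  neg : ∀ s, form M v (sroot s) < 0

theorem exists_isNegVector (hirr : IsIrreducible M) (h : ¬ IsPosSemidef M) :
    ∃ v, IsNegVector M v := by
  obtain ⟨c, v, hc, hv0, hv1, hvc, hmin⟩ := exists_min_form h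
  have heig : ∀ u, form M v u = c * (v ⬝ᵥ u) := by
    intro u
    set b := form M v u - c * (v ⬝ᵥ u) with hb
    set d := form M u u - c * (u ⬝ᵥ u) with hd
    have hd0 : 0 ≤ d := sub_nonneg.mpr (hmin u)
    have h1 := hmin (v + (-b / (d + 1)) • u)
    simp only [map_add, map_smul, LinearMap.add_apply, LinearMap.smul_apply, smul_eq_mul,
      add_dotProduct, dotProduct_add, smul_dotProduct, dotProduct_smul, form_symm M u v,
      dotProduct_comm u v, hv1, hvc] at h1
    have h2 : 0 ≤ 2 * (-b / (d + 1)) * b + (-b / (d + 1)) ^ 2 * d := by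
      rw [hb, hd] at *
      linarith
    have h3 : 2 * (-b / (d + 1)) * b + (-b / (d + 1)) ^ 2 * d
      = -(b ^ 2 * (d + 2)) / (d + 1) ^ 2 := by
      field_simp
      ring
    rw [h3] at h2
    have h4 : 0 ≤ -(b ^ 2 * (d + 2)) := by
      have hd1 : 0 < (d + 1) ^ 2 := by positivity
      by_contra! hcon
      exact absurd h2 (not_le.mpr (div_neg_of_neg_of_pos hcon hd1))
    have h5 : b = 0 := by
      by_contra hne
      have : 0 < b ^ 2 := by positivity
      nlinarith
    linarith
  have hpos : ∀ s, 0 < v s := by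
    by_contra! hcon
    obtain ⟨s, hs⟩ := hcon
    have hs0 : v s = 0 := le_antisymm hs (hv0 s)
    have hall : ∀ t, v t = 0 := by
      refine fun t => hirr.induction (P := fun t => v t = 0) ?_ hs0 t
      intro a b hab ha
      have h1 := heig (sroot a)
      rw [dotProduct_sroot, ha, mul_zero, form_sroot_right] at h1
      have h2 : ∀ t ∈ Finset.univ, v t * formEntry M t a ≤ 0 := by
        intro t _
        by_cases hta : t = a
        · rw [hta, ha, zero_mul]
        · exact mul_nonpos_of_nonneg_of_nonpos (hv0 t) (formEntry_nonpos M hta)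
      have h3 := (Finset.sum_eq_zero_iff_of_nonpos h2).mp h1 b (Finset.mem_univ b)
      exact (mul_eq_zero.mp h3).resolve_right (formEntry_ne_zero_of_adj M hab.symm).ne
    have : v = 0 := funext hall
    simp [this] at hv1
  refine ⟨v, hpos, fun s => ?_⟩
  rw [heig, dotProduct_sroot]
  exact mul_neg_of_neg_of_pos hc (hpos s)

lemma IsNegVector.form_self_neg [Nonempty B] {v : B → ℝ} (h : IsNegVector M v) :
    form M v v < 0 := by
  rw [form_eq_sum]
  exact Finset.sum_neg (fun s _ => mul_neg_of_pos_of_neg (h.pos s) (h.neg s))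
    Finset.univ_nonempty

end PerronFrobenius

section Growth

variable {B W : Type*} [Fintype B] [Group W] {M : CoxeterMatrix B} {cs : CoxeterSystem M W}

lemma IsRoot.one_le_sum {β : B → ℝ} (h : IsRoot cs β) (h0 : 0 ≤ β) : 1 ≤ ∑ s, β s := by
  have h1 := h.form_self
  have h2 : form M β β ≤ (∑ s, β s) * ∑ s, β s := by
    rw [form_apply, bilin, Finset.sum_mul_sum]
    refine Finset.sum_le_sum fun i _ => Finset.sum_le_sum fun j _ => ?_
    have hij : 0 ≤ β i * β j := mul_nonneg (h0 i) (h0 j)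
    by_cases hne : i = j
    · subst hne
      rw [formEntry_self, mul_one]
    · exact (mul_nonpos_of_nonneg_of_nonpos hij (formEntry_nonpos M hne)).trans hij
  have h3 : 0 ≤ ∑ s, β s := Finset.sum_nonneg fun s _ => h0 s
  nlinarith

variable (cs)

/-- Moving the negative vector by `w` decreases its pairing linearly in the length of `w`. -/
theorem IsNegVector.exists_form_rho_le [Nonempty B] {v : B → ℝ} (hv : IsNegVector M v) :
    ∃ ε > 0, ∀ w, form M (rho cs w v) v ≤ form M v v - ε * cs.length w := by
  obtain ⟨s₀, hs₀⟩ := Finite.exists_max fun s => form M v (sroot s)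
  set m := form M v (sroot s₀)
  have hm : m < 0 := hv.neg s₀
  refine ⟨2 * m ^ 2, by nlinarith, fun w => ?_⟩
  induction hn : cs.length w generalizing w with
  | zero =>
    rw [cs.length_eq_zero_iff.mp hn, rho_one_apply]
    simp
  | succ n ih =>
    have hw : w ≠ 1 := by
      rintro rfl
      simp at hn
    obtain ⟨s, hs⟩ := cs.exists_rightDescent_of_ne_one hw
    have hl := cs.isRightDescent_iff.mp hs
    have h1 := ih (w * cs.simple s) (by omega)
    have hβ := rho_sroot_nonneg cs (w * cs.simple s) s
      (by rw [cs.simple_mul_simple_cancel_right]; exact hs)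
    have hroot : IsRoot cs (rho cs (w * cs.simple s) (sroot s)) := ⟨_, _, rfl⟩
    have hsum := hroot.one_le_sum hβ
    have e : rho cs w v = rho cs (w * cs.simple s) v -
        (2 * form M v (sroot s)) • rho cs (w * cs.simple s) (sroot s) := by
      rw [← map_smul, ← map_sub, ← refl_apply, ← rho_simple cs s, ← rho_mul_apply,
        cs.simple_mul_simple_cancel_right]
    set β := rho cs (w * cs.simple s) (sroot s)
    have h2 : form M β v ≤ m := by
      rw [form_symm, form_eq_sum]
      calc ∑ t, β t * form M v (sroot t) ≤ ∑ t, β t * m :=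
            Finset.sum_le_sum fun t _ => mul_le_mul_of_nonneg_left (hs₀ t) (hβ t)
        _ = (∑ t, β t) * m := by rw [Finset.sum_mul]
        _ ≤ m := by nlinarith
    rw [e, map_sub, map_smul, LinearMap.sub_apply, LinearMap.smul_apply, smul_eq_mul]
    have h3 := hs₀ s
    push_cast
    nlinarith

variable {cs}

lemma IsNegVector.eq_one_of_form_rho_eq [Nonempty B] {v : B → ℝ} (hv : IsNegVector M v) {w : W}
    (h : form M v v ≤ form M (rho cs w v) v) : w = 1 := by
  obtain ⟨ε, hε, hle⟩ := hv.exists_form_rho_le cs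
  have := hle w
  rw [← cs.length_eq_zero_iff]
  by_contra hne
  have : (0 : ℝ) < cs.length w := by exact_mod_cast Nat.pos_of_ne_zero hne
  have := mul_pos hε this
  linarith

lemma exists_length_gt [Infinite W] (n : ℕ) : ∃ w, n < cs.length w := by
  by_contra! hcon
  have hfin : (Set.univ : Set W).Finite := by
    refine ((List.finite_length_le B n).image cs.wordProd).subset fun w _ => ?_
    obtain ⟨ω, hω, rfl⟩ := cs.exists_isReduced w
    exact ⟨ω, by rw [Set.mem_ofPred_eq, ← hω.eq]; exact hcon _, rfl⟩
  exact Set.infinite_univ hfin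

/-- The radical of the standard form. -/
noncomputable def radical (M : CoxeterMatrix B) : Submodule ℝ (B → ℝ) := LinearMap.ker (form M)

lemma mem_radical {v : B → ℝ} : v ∈ radical M ↔ ∀ u, form M v u = 0 := by
  rw [radical, LinearMap.mem_ker]
  exact ⟨fun h u => by rw [h]; rfl, fun h => LinearMap.ext h⟩

lemma form_of_mem_radical_left {v : B → ℝ} (h : v ∈ radical M) (u : B → ℝ) : form M v u = 0 :=
  mem_radical.mp h u

lemma form_of_mem_radical_right {v : B → ℝ} (h : v ∈ radical M) (u : B → ℝ) : form M u v = 0 := by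
  rw [form_symm, mem_radical.mp h u]

lemma rho_mem_radical {v : B → ℝ} (h : v ∈ radical M) (w : W) : rho cs w v ∈ radical M := by
  rw [mem_radical] at h ⊢
  intro u
  rw [form_rho_left, h]

lemma eq_one_of_rho_sub_mem_radical (hirr : IsIrreducible M) (hneg : ¬ IsPosSemidef M) {w : W}
    (h : ∀ v, rho cs w v - v ∈ radical M) : w = 1 := by
  have : Nonempty B := hirr.nonempty
  obtain ⟨v, hv⟩ := exists_isNegVector hirr hneg
  refine hv.eq_one_of_form_rho_eq (cs := cs) ?_
  have := form_of_mem_radical_left (h v) v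
  rw [map_sub, LinearMap.sub_apply] at this
  linarith

/-- A submodule stable under all simple reflections is everything or lies in the radical. -/
lemma eq_top_of_refl_stable (hirr : IsIrreducible M) {X : Submodule ℝ (B → ℝ)}
    (hX : ∀ s, ∀ x ∈ X, refl M (sroot s) x ∈ X) (hR : ¬ X ≤ radical M) : X = ⊤ := by
  obtain ⟨x, hx, hxR⟩ := SetLike.not_le_iff_exists.mp hR
  have hmem : ∀ y ∈ X, ∀ s, form M y (sroot s) ≠ 0 → sroot s ∈ X := by
    intro y hy s hs
    have h1 := X.sub_mem hy (hX s y hy)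
    rw [refl_apply, sub_sub_cancel] at h1
    exact (X.smul_mem_iff (mul_ne_zero two_ne_zero hs)).mp h1
  obtain ⟨s, hs⟩ : ∃ s, form M x (sroot s) ≠ 0 := by
    by_contra! hcon
    apply hxR
    rw [mem_radical]
    intro u
    rw [form_eq_sum]
    simp [hcon]
  have hall : ∀ t, (sroot t : B → ℝ) ∈ X := by
    refine fun t => hirr.induction (P := fun t => sroot t ∈ X) ?_ (hmem x hx s hs) t
    intro a b hab ha
    refine hmem _ ha b ?_
    rw [form_sroot_sroot]
    exact (formEntry_ne_zero_of_adj M hab).ne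
  rw [eq_top_iff]
  intro u _
  rw [eq_sum_sroot u]
  exact X.sum_mem fun s _ => X.smul_mem _ (hall s)

end Growth

section Skewering

open Filter

/-- The vectors `u` such that the family `f` of linear forms is bounded at `u`. -/
def boundedVectors {B W : Type*} (f : W → (B → ℝ) →ₗ[ℝ] ℝ) : Submodule ℝ (B → ℝ) where
  carrier := {u | ∃ C, ∀ w, |f w u| ≤ C}
  add_mem' := by
    rintro a b ⟨C, hC⟩ ⟨D, hD⟩
    refine ⟨C + D, fun w => ?_⟩
    rw [map_add]
    exact (abs_add_le _ _).trans (add_le_add (hC w) (hD w))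
  zero_mem' := ⟨0, by simp⟩
  smul_mem' := by
    rintro c a ⟨C, hC⟩
    refine ⟨|c| * C, fun w => ?_⟩
    rw [map_smul, smul_eq_mul, abs_mul]
    exact mul_le_mul_of_nonneg_left (hC w) (abs_nonneg c)

lemma mem_boundedVectors {B W : Type*} {f : W → (B → ℝ) →ₗ[ℝ] ℝ} {u : B → ℝ} :
    u ∈ boundedVectors f ↔ ∃ C, ∀ w, |f w u| ≤ C := Iff.rfl

variable {B W : Type*} [Fintype B] [Group W] {M : CoxeterMatrix B} {cs : CoxeterSystem M W}

lemma sroot_notMem_radical (s : B) : sroot s ∉ radical M := fun h => by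
  have := form_of_mem_radical_left h (sroot s)
  rw [form_sroot_self] at this
  exact one_ne_zero this

lemma refl_mem_of_rho_mem {X : Submodule ℝ (B → ℝ)} (h : ∀ w, ∀ x ∈ X, rho cs w x ∈ X) (s : B) :
    ∀ x ∈ X, refl M (sroot s) x ∈ X := by
  rw [← rho_simple cs]
  exact h _

variable (cs) in
lemma exists_one_lt_abs_form [Infinite W] (hirr : IsIrreducible M) (hneg : ¬ IsPosSemidef M)
    (s : B) : ∃ w, 1 < |form M (sroot s) (rho cs w (sroot s))| := by
  by_contra! hcon
  have : Nonempty B := ⟨s⟩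
  obtain ⟨v, hv⟩ := exists_isNegVector hirr hneg
  have h1 : boundedVectors (fun w => form M (rho cs w (sroot s))) = ⊤ := by
    refine eq_top_of_refl_stable hirr (refl_mem_of_rho_mem (cs := cs) ?_) ?_
    · rintro w x ⟨C, hC⟩
      refine ⟨C, fun y => ?_⟩
      have := hC (w⁻¹ * y)
      dsimp only at this ⊢
      rwa [rho_mul_apply, form_rho_left, inv_inv] at this
    · refine fun hle => sroot_notMem_radical (M := M) s (hle ⟨1, fun w => ?_⟩)
      rw [form_symm]
      exact hcon w
  have h2 : boundedVectors (fun w => (form M v).comp (rho cs w)) = ⊤ := by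
    refine eq_top_of_refl_stable hirr (refl_mem_of_rho_mem (cs := cs) ?_) ?_
    · rintro w x ⟨C, hC⟩
      refine ⟨C, fun y => ?_⟩
      have := hC (y * w)
      dsimp only at this ⊢
      rwa [LinearMap.comp_apply, rho_mul_apply] at this
    · refine fun hle => sroot_notMem_radical (M := M) s (hle ?_)
      obtain ⟨C, hC⟩ := mem_boundedVectors.mp (h1 ▸ Submodule.mem_top (x := v))
      refine ⟨C, fun w => ?_⟩
      rw [LinearMap.comp_apply, form_symm]
      exact hC w
  obtain ⟨C, hC⟩ := mem_boundedVectors.mp (h2 ▸ Submodule.mem_top (x := v))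
  obtain ⟨ε, hε, hle⟩ := hv.exists_form_rho_le cs
  obtain ⟨n, hn⟩ := exists_nat_gt ((C + form M v v) / ε)
  obtain ⟨w, hw⟩ := exists_length_gt (cs := cs) n
  have h3 := hle w
  have h4 := hC w
  rw [LinearMap.comp_apply, form_symm] at h4
  have h5 := neg_le_of_abs_le h4
  rw [div_lt_iff₀ hε] at hn
  have h6 : (n : ℝ) < cs.length w := by exact_mod_cast hw
  nlinarith

/-- A root is skewered by `g` if its two ends along powers of `g` have opposite signs. -/
def Skewers (cs : CoxeterSystem M W) (g : W) (γ : B → ℝ) : Prop :=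
  IsRoot cs γ ∧
    ((∀ᶠ n : ℕ in atTop, 0 ≤ rho cs (g ^ n) γ ∧ rho cs (g⁻¹ ^ n) γ ≤ 0) ∨
      ∀ᶠ n : ℕ in atTop, 0 ≤ rho cs (g⁻¹ ^ n) γ ∧ rho cs (g ^ n) γ ≤ 0)

lemma Skewers.inv {g : W} {γ : B → ℝ} (h : Skewers cs g γ) : Skewers cs g⁻¹ γ := by
  refine ⟨h.1, ?_⟩
  rw [inv_inv]
  exact h.2.symm

lemma rho_pow_eq_self {g : W} {γ : B → ℝ} (h : rho cs g γ = γ) (n : ℕ) :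
    rho cs (g ^ n) γ = γ := by
  rw [map_pow, Module.End.pow_apply]
  exact Function.iterate_fixed h n

lemma rho_inv_eq_self {g : W} {γ : B → ℝ} (h : rho cs g γ = γ) : rho cs g⁻¹ γ = γ := by
  conv_lhs => rw [← h]
  exact rho_inv_rho cs g γ

lemma Skewers.pow_eq_zero {g : W} {γ : B → ℝ} (h : Skewers cs g γ) {k : ℕ}
    (hk : rho cs (g ^ k) γ = γ) : k = 0 := by
  by_contra hk0
  have h1 : ∀ n : ℕ, rho cs (g ^ (k * n)) γ = γ := fun n => by
    rw [pow_mul]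
    exact rho_pow_eq_self hk n
  have h2 : ∀ n : ℕ, rho cs (g⁻¹ ^ (k * n)) γ = γ := fun n => by
    rw [inv_pow]
    exact rho_inv_eq_self (h1 n)
  have ht : Tendsto (fun n : ℕ => k * n) atTop atTop :=
    tendsto_id.const_mul_atTop' (Nat.pos_of_ne_zero hk0)
  rcases h.2 with h3 | h3
  · obtain ⟨n, hn⟩ := (ht.eventually h3).exists
    rw [h1, h2] at hn
    exact h.1.not_nonneg_nonpos hn.1 hn.2
  · obtain ⟨n, hn⟩ := (ht.eventually h3).exists
    rw [h1, h2] at hn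
    exact h.1.not_nonneg_nonpos hn.1 hn.2

lemma Skewers.zpow_eq_zero {g : W} {γ : B → ℝ} (h : Skewers cs g γ) {k : ℤ}
    (hk : rho cs (g ^ k) γ = γ) : k = 0 := by
  obtain ⟨n, rfl | rfl⟩ := k.eq_nat_or_neg
  · rw [zpow_natCast] at hk
    rw [h.pow_eq_zero hk, Nat.cast_zero]
  · rw [zpow_neg, zpow_natCast] at hk
    have := rho_inv_eq_self hk
    rw [inv_inv] at this
    rw [h.pow_eq_zero this, Nat.cast_zero, neg_zero]

lemma Skewers.injective_pow {g : W} {γ : B → ℝ} (h : Skewers cs g γ) :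
    Function.Injective fun n : ℕ => rho cs (g ^ n) γ := by
  intro m n hmn
  have : rho cs (g ^ ((m : ℤ) - n)) γ = γ := by
    have h1 : rho cs (g ^ m) γ = rho cs (g ^ n) γ := hmn
    rw [sub_eq_neg_add, zpow_add, rho_mul_apply, zpow_natCast, h1, zpow_neg, zpow_natCast,
      rho_inv_rho]
  have := h.zpow_eq_zero this
  omega

lemma eventually_rho_nonneg {f : ℕ → B → ℝ} (hf : Function.Injective f)
    (hroot : ∀ n, IsRoot cs (f n)) (hpos : ∀ᶠ n in atTop, 0 ≤ f n) (z : W) :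
    ∀ᶠ n in atTop, 0 ≤ rho cs z (f n) := by
  have h1 : ∀ᶠ n in atTop, f n ∉ {β | IsRoot cs β ∧ 0 ≤ β ∧ rho cs z β ≤ 0} := by
    rw [← Nat.cofinite_eq_atTop]
    exact hf.tendsto_cofinite.eventually (finite_inversions cs z).eventually_cofinite_notMem
  filter_upwards [h1, hpos] with n hn hp
  rw [← ((hroot n).rho z).not_nonpos_iff]
  exact fun hle => hn ⟨hroot n, hp, hle⟩

lemma eventually_rho_nonpos {f : ℕ → B → ℝ} (hf : Function.Injective f)
    (hroot : ∀ n, IsRoot cs (f n)) (hneg : ∀ᶠ n in atTop, f n ≤ 0) (z : W) :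
    ∀ᶠ n in atTop, rho cs z (f n) ≤ 0 := by
  have := eventually_rho_nonneg (f := fun n => -f n) (fun m n hmn => hf (neg_injective hmn))
    (fun n => (hroot n).neg) (hneg.mono fun n hn => neg_nonneg.mpr hn) z
  refine this.mono fun n hn => ?_
  rw [map_neg] at hn
  exact neg_nonneg.mp hn

lemma rho_comm_apply {z g : W} (h : Commute z g) (γ : B → ℝ) :
    rho cs g (rho cs z γ) = rho cs z (rho cs g γ) := by
  rw [← rho_mul_apply, ← rho_mul_apply, h.eq]

lemma Skewers.rho_of_commute {g z : W} {γ : B → ℝ} (h : Skewers cs g γ) (hz : Commute z g) :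
    Skewers cs g (rho cs z γ) := by
  refine ⟨h.1.rho z, ?_⟩
  have e1 : ∀ n : ℕ, rho cs (g ^ n) (rho cs z γ) = rho cs z (rho cs (g ^ n) γ) := fun n =>
    rho_comm_apply (hz.pow_right n) γ
  have e2 : ∀ n : ℕ, rho cs (g⁻¹ ^ n) (rho cs z γ) = rho cs z (rho cs (g⁻¹ ^ n) γ) := fun n =>
    rho_comm_apply (hz.inv_right.pow_right n) γ
  simp only [e1, e2]
  refine h.2.imp (fun h2 => ?_) fun h2 => ?_
  · exact (eventually_rho_nonneg h.injective_pow (fun n => h.1.rho _) (h2.mono fun n hn => hn.1)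
      z).and (eventually_rho_nonpos h.inv.injective_pow (fun n => h.1.rho _)
        (h2.mono fun n hn => hn.2) z)
  · exact (eventually_rho_nonneg h.inv.injective_pow (fun n => h.1.rho _)
      (h2.mono fun n hn => hn.1) z).and (eventually_rho_nonpos h.injective_pow
        (fun n => h.1.rho _) (h2.mono fun n hn => hn.2) z)

/-- Up to powers of `g` there are finitely many roots skewered by `g`. -/
lemma exists_finite_skewers (cs : CoxeterSystem M W) (g : W) : ∃ F : Set (B → ℝ), F.Finite ∧
    ∀ γ, Skewers cs g γ → ∃ n : ℤ, rho cs (g ^ n) γ ∈ F := by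
  refine ⟨_, (finite_inversions cs g).union (finite_inversions cs g⁻¹), fun γ h => ?_⟩
  by_contra! hcon
  have hstep : ∀ n : ℤ, 0 ≤ rho cs (g ^ n) γ ↔ 0 ≤ rho cs (g ^ (n + 1)) γ := by
    intro n
    constructor
    · intro h1
      rw [← (h.1.rho _).not_nonpos_iff]
      intro h2
      refine hcon n (.inl ⟨h.1.rho _, h1, ?_⟩)
      rwa [← rho_mul_apply, ← zpow_one_add, add_comm]
    · intro h1
      rw [← (h.1.rho _).not_nonpos_iff]
      intro h2
      refine hcon (n + 1) (.inr ⟨h.1.rho _, h1, ?_⟩)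
      rwa [add_comm, zpow_one_add, rho_mul_apply, rho_inv_rho]
  have hall : ∀ n : ℤ, 0 ≤ rho cs (g ^ n) γ ↔ 0 ≤ γ := by
    intro n
    induction n using Int.induction_on with
    | zero => rw [zpow_zero, rho_one_apply]
    | succ n ih => rw [← hstep, ih]
    | pred n ih => rw [hstep, sub_add_cancel, ih]
  have h1 : ∀ n : ℕ, 0 ≤ rho cs (g ^ n) γ ↔ 0 ≤ γ := fun n => by simpa using hall n
  have h2 : ∀ n : ℕ, 0 ≤ rho cs (g⁻¹ ^ n) γ ↔ 0 ≤ γ := fun n => by simpa using hall (-n)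
  rcases h.2 with h3 | h3
  · obtain ⟨n, hn⟩ := h3.exists
    exact (h.1.rho _).not_nonneg_nonpos ((h2 n).mpr ((h1 n).mp hn.1)) hn.2
  · obtain ⟨n, hn⟩ := h3.exists
    exact (h.1.rho _).not_nonneg_nonpos ((h1 n).mpr ((h2 n).mp hn.1)) hn.2

lemma rho_pow_eq_of_commute {g h : W} {γ : B → ℝ} (hc : Commute h g) {m : ℤ}
    (e : rho cs h γ = rho cs (g ^ m) γ) (n : ℕ) : rho cs (h ^ n) γ = rho cs (g ^ (m * n)) γ := by
  induction n with
  | zero => simp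
  | succ n ih =>
    rw [pow_succ, rho_mul_apply, e, rho_comm_apply ((hc.zpow_right m).symm.pow_right n), ih,
      ← rho_mul_apply, ← zpow_add]
    congr 3
    push_cast
    ring

lemma Skewers.of_pow_eq {g h : W} {γ : B → ℝ} (hs : Skewers cs g γ) (hc : Commute h g) {m : ℕ}
    (hm : m ≠ 0) (e : rho cs h γ = rho cs (g ^ m) γ) : Skewers cs h γ := by
  refine ⟨hs.1, ?_⟩
  have e1 : ∀ n : ℕ, rho cs (h ^ n) γ = rho cs (g ^ (m * n)) γ := by
    intro n
    rw [rho_pow_eq_of_commute hc (m := m) (by rwa [zpow_natCast])]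
    norm_cast
  have e' : rho cs h⁻¹ γ = rho cs (g ^ (-(m : ℤ))) γ := by
    have h1 : rho cs h (rho cs (g ^ (-(m : ℤ))) γ) = γ := by
      rw [rho_comm_apply (hc.symm.zpow_left _), e, zpow_neg, zpow_natCast, rho_inv_rho]
    rw [← h1, rho_inv_rho, h1]
  have e2 : ∀ n : ℕ, rho cs (h⁻¹ ^ n) γ = rho cs (g⁻¹ ^ (m * n)) γ := by
    intro n
    rw [rho_pow_eq_of_commute hc.inv_left e', inv_pow, neg_mul, zpow_neg]
    norm_cast
  have ht : Tendsto (fun n : ℕ => m * n) atTop atTop :=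
    tendsto_id.const_mul_atTop' (Nat.pos_of_ne_zero hm)
  simp only [e1, e2]
  exact hs.2.imp (fun h2 => ht.eventually h2) fun h2 => ht.eventually h2

lemma Skewers.of_zpow_eq {g h : W} {γ : B → ℝ} (hs : Skewers cs g γ) (hc : Commute h g) {m : ℤ}
    (hm : m ≠ 0) (e : rho cs h γ = rho cs (g ^ m) γ) : Skewers cs h γ := by
  obtain ⟨n, rfl | rfl⟩ := m.eq_nat_or_neg
  · exact hs.of_pow_eq hc (m := n) (by omega) (by rwa [zpow_natCast] at e)
  · refine hs.inv.of_pow_eq hc.inv_right (m := n) (by omega) ?_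
    rwa [zpow_neg, zpow_natCast, ← inv_pow] at e

lemma rho_conj_simple (x : W) (s : B) (v : B → ℝ) :
    rho cs (x * cs.simple s * x⁻¹) v = refl M (rho cs x (sroot s)) v := by
  rw [rho_mul_apply, rho_mul_apply, rho_simple, refl_apply, refl_apply, map_sub, map_smul,
    rho_rho_inv, form_rho_left, inv_inv]

variable (cs) in
lemma exists_isRoot_form_lt [Infinite W] (hirr : IsIrreducible M) (hneg : ¬ IsPosSemidef M)
    (s : B) : ∃ β, IsRoot cs β ∧ 0 ≤ β ∧ form M (sroot s) β < -1 := by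
  obtain ⟨w, hw⟩ := exists_one_lt_abs_form cs hirr hneg s
  obtain ⟨γ, hγ, hlt⟩ : ∃ γ, IsRoot cs γ ∧ form M (sroot s) γ < -1 := by
    have hr : IsRoot cs (rho cs w (sroot s)) := ⟨w, s, rfl⟩
    rcases lt_abs.mp hw with h | h
    · exact ⟨_, hr.neg, by rw [map_neg]; linarith⟩
    · exact ⟨_, hr, by linarith⟩
  rcases hγ.nonneg_or_nonpos with h | h
  · exact ⟨γ, hγ, h, hlt⟩
  · refine ⟨rho cs (cs.simple s) (-γ), hγ.neg.rho _,
      hγ.neg.rho_simple_nonneg (neg_nonneg.mpr h) s ?_, ?_⟩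
    · intro e
      rw [← neg_eq_iff_eq_neg.mpr e.symm, map_neg, form_sroot_self] at hlt
      exact lt_irrefl _ hlt
    · rw [← form_rho cs (cs.simple s), ← rho_mul_apply, cs.simple_mul_simple_self, rho_one_apply,
        rho_simple_sroot_self, map_neg, map_neg, LinearMap.neg_apply, neg_neg]
      exact hlt

lemma le_two_mul_mul_sub {q a b : ℝ} (hq : 1 < q) (ha : 0 ≤ a) (h : b ≤ a) :
    a ≤ 2 * q * a - b := by
  nlinarith

theorem exists_skewers (cs : CoxeterSystem M W) [Infinite W] (hirr : IsIrreducible M)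
    (hneg : ¬ IsPosSemidef M) (s : B) : ∃ g, Skewers cs g (sroot s) := by
  obtain ⟨β, hβ, h0, hlt⟩ := exists_isRoot_form_lt cs hirr hneg s
  obtain ⟨x, r, hx⟩ := id hβ
  set α : B → ℝ := sroot s with hα
  have hα0 : 0 ≤ α := sroot_nonneg s
  have hαα : form M α α = 1 := form_sroot_self M s
  obtain ⟨q, hq⟩ : ∃ q, q = -form M α β := ⟨_, rfl⟩
  have hq1 : 1 < q := by linarith
  have eα : form M α β = -q := by linarith
  have eβ : form M β α = -q := by rw [form_symm]; linarith
  set t := x * cs.simple r * x⁻¹ with ht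
  have ht' : ∀ v, rho cs t v = refl M β v := fun v => by rw [hx, ht, rho_conj_simple]
  have hs' : ∀ v, rho cs (cs.simple s) v = refl M α v := fun v => by rw [rho_simple]
  have htinv : t⁻¹ = t := by simp [ht, mul_assoc]
  have hg : ∀ n : ℕ, ∃ a b : ℝ, 0 ≤ b ∧ b ≤ a ∧
      rho cs ((cs.simple s * t) ^ n) α = a • α + b • β := by
    intro n
    induction n with
    | zero => exact ⟨1, 0, le_rfl, zero_le_one, by simp⟩
    | succ n ih =>
      obtain ⟨a, b, hb, hba, e⟩ := ih
      have h1 := le_two_mul_mul_sub hq1 (hb.trans hba) hba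
      have h2 := (hb.trans hba).trans h1
      refine ⟨2 * q * (2 * q * a - b) - a, 2 * q * a - b, h2, le_two_mul_mul_sub hq1 h2 h1, ?_⟩
      rw [pow_succ', rho_mul_apply, e, rho_mul_apply, ht', hs', refl_apply, refl_apply]
      simp only [map_add, map_sub, map_smul, LinearMap.add_apply, LinearMap.smul_apply,
        LinearMap.sub_apply, smul_eq_mul, eα, eβ, hαα, hβ.form_self]
      module
  have hg' : ∀ n : ℕ, ∃ a b : ℝ, 0 ≤ a ∧ a ≤ b ∧
      rho cs ((cs.simple s * t)⁻¹ ^ (n + 1)) α = -(a • α + b • β) := by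
    have e0 : (cs.simple s * t)⁻¹ = t * cs.simple s := by
      rw [mul_inv_rev, htinv, cs.inv_simple]
    rw [e0]
    intro n
    induction n with
    | zero =>
      refine ⟨1, 2 * q, zero_le_one, by linarith, ?_⟩
      rw [zero_add, pow_one, rho_mul_apply, hs', ht', refl_self M hαα, map_neg, refl_apply, eα]
      module
    | succ n ih =>
      obtain ⟨a, b, ha, hab, e⟩ := ih
      have h1 := le_two_mul_mul_sub hq1 (ha.trans hab) hab
      have h2 := (ha.trans hab).trans h1
      refine ⟨2 * q * b - a, 2 * q * (2 * q * b - a) - b, h2, le_two_mul_mul_sub hq1 h2 h1, ?_⟩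
      rw [pow_succ', rho_mul_apply, e, rho_mul_apply, ht', hs', refl_apply, refl_apply]
      simp only [map_add, map_sub, map_smul, map_neg, LinearMap.add_apply, LinearMap.smul_apply,
        LinearMap.sub_apply, LinearMap.neg_apply, smul_eq_mul, eα, eβ, hαα, hβ.form_self]
      module
  refine ⟨cs.simple s * t, isRoot_sroot cs s, .inl ?_⟩
  filter_upwards [eventually_ge_atTop 1] with n hn
  obtain ⟨m, rfl⟩ : ∃ m, n = m + 1 := ⟨n - 1, by omega⟩
  constructor
  · obtain ⟨a, b, hb, hba, e⟩ := hg (m + 1)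
    rw [e]
    exact add_nonneg (smul_nonneg (hb.trans hba) hα0) (smul_nonneg hb h0)
  · obtain ⟨a, b, ha, hab, e⟩ := hg' m
    rw [e, neg_nonpos]
    exact add_nonneg (smul_nonneg ha hα0) (smul_nonneg (ha.trans hab) h0)

/-- Every finite index subgroup contains an element skewering a given simple root. -/
lemma exists_mem_skewers (cs : CoxeterSystem M W) [Infinite W] (hirr : IsIrreducible M)
    (hneg : ¬ IsPosSemidef M) (K : Subgroup W) [K.FiniteIndex] (s : B) :
    ∃ g ∈ K, Skewers cs g (sroot s) := by
  obtain ⟨g, hg⟩ := exists_skewers cs hirr hneg s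
  obtain ⟨n, hn, -, hmem⟩ := Subgroup.exists_pow_mem_of_index_ne_zero K.index_ne_zero_of_finite g
  refine ⟨g ^ n, hmem, hg.of_pow_eq (Commute.refl g |>.pow_left n) hn.ne' rfl⟩

end Skewering

section Irreducibility

lemma conj_simple_mem {B W : Type*} [Group W] {M : CoxeterMatrix B}
    {cs : CoxeterSystem M W} {N : Subgroup W} [N.Normal] (s : B) {n : W} (hn : n ∈ N) :
    cs.simple s * n * cs.simple s ∈ N := by
  have := Subgroup.Normal.conj_mem ‹N.Normal› n hn (cs.simple s)
  rwa [cs.inv_simple] at this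

variable {B W : Type*} [Fintype B] [Group W] {M : CoxeterMatrix B} {cs : CoxeterSystem M W}

/-- Three vectors in the span of two vectors and the radical have vanishing Gram determinant. -/
lemma gram_det_eq_zero {x y u₁ u₂ u₃ : B → ℝ}
    (h : ∀ u, ∃ p q : ℝ, u - (p • x + q • y) ∈ radical M) :
    form M u₁ u₁ * (form M u₂ u₂ * form M u₃ u₃ - form M u₂ u₃ * form M u₂ u₃) -
      form M u₁ u₂ * (form M u₁ u₂ * form M u₃ u₃ - form M u₂ u₃ * form M u₁ u₃) +
      form M u₁ u₃ * (form M u₁ u₂ * form M u₂ u₃ - form M u₂ u₂ * form M u₁ u₃) = 0 := by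
  obtain ⟨p₁, q₁, h₁⟩ := h u₁
  obtain ⟨p₂, q₂, h₂⟩ := h u₂
  obtain ⟨p₃, q₃, h₃⟩ := h u₃
  have key : ∀ {u u' : B → ℝ} {p q p' q' : ℝ}, u - (p • x + q • y) ∈ radical M →
      u' - (p' • x + q' • y) ∈ radical M → form M u u' =
        p * p' * form M x x + (p * q' + q * p') * form M x y + q * q' * form M y y := by
    intro u u' p q p' q' hu hu'
    have e1 := form_of_mem_radical_left hu u'
    have e2 := form_of_mem_radical_right hu' (p • x + q • y)
    simp only [map_sub, map_add, map_smul, LinearMap.sub_apply, LinearMap.add_apply,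
      LinearMap.smul_apply, smul_eq_mul, form_symm M y x] at e1 e2
    linarith
  rw [key h₁ h₁, key h₂ h₂, key h₃ h₃, key h₁ h₂, key h₂ h₃, key h₁ h₃]
  ring

/-- Modulo its radical, an indefinite form has rank at least three. -/
lemma not_forall_mem_span_pair (hirr : IsIrreducible M) (hneg : ¬ IsPosSemidef M) (x y : B → ℝ) :
    ¬ ∀ u, ∃ p q : ℝ, u - (p • x + q • y) ∈ radical M := by
  intro h
  obtain ⟨v, hv⟩ := exists_isNegVector hirr hneg
  have : Nonempty B := hirr.nonempty
  rcases subsingleton_or_nontrivial B with hB | hB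
  · apply hneg
    intro u
    rw [bilin]
    refine Finset.sum_nonneg fun i _ => Finset.sum_nonneg fun j _ => ?_
    rw [Subsingleton.elim j i, formEntry_self, mul_one]
    exact mul_self_nonneg _
  · obtain ⟨s, r, hsr⟩ := exists_pair_ne B
    have hdet := gram_det_eq_zero (M := M) (u₁ := sroot s) (u₂ := sroot r) (u₃ := v) h
    have hp := hv.neg s
    have hr := hv.neg r
    rw [form_symm] at hp hr
    have hw := hv.form_self_neg
    have hb := formEntry_nonpos M hsr
    have hb' := neg_one_le_formEntry M s r
    rw [form_sroot_self, form_sroot_self, form_sroot_sroot] at hdet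
    set b := formEntry M s r
    set p := form M (sroot s) v
    set q := form M (sroot r) v
    have h1 : 0 < p * q := mul_pos_of_neg_of_neg hp hr
    have h2 : b * (p * q) ≤ 0 := mul_nonpos_of_nonpos_of_nonneg hb h1.le
    have h3 : form M v v * (1 - b * b) ≤ 0 :=
      mul_nonpos_of_nonpos_of_nonneg hw.le (by nlinarith)
    nlinarith

/-- The vectors on which `N` acts through the scalars `χ` modulo the radical. -/
noncomputable def eigenMod (cs : CoxeterSystem M W) (N : Subgroup W) (χ : W → ℝ) :
    Submodule ℝ (B → ℝ) :=
  ⨅ n ∈ N, (radical M).comap (rho cs n - χ n • (1 : Module.End ℝ (B → ℝ)))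

lemma mem_eigenMod {N : Subgroup W} {χ : W → ℝ} {y : B → ℝ} :
    y ∈ eigenMod cs N χ ↔ ∀ n ∈ N, rho cs n y - χ n • y ∈ radical M := by
  simp [eigenMod, Submodule.mem_iInf]

lemma rho_rho_simple (n : W) (s : B) (y : B → ℝ) : rho cs n (rho cs (cs.simple s) y) =
    rho cs (cs.simple s) (rho cs (cs.simple s * n * cs.simple s) y) := by
  simp only [← rho_mul_apply, mul_assoc, cs.simple_mul_simple_cancel_left]

lemma rho_simple_mem_eigenMod {N : Subgroup W} [N.Normal] {χ ψ : W → ℝ} {s : B}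
    (h : ∀ n ∈ N, χ (cs.simple s * n * cs.simple s) = ψ n) {y : B → ℝ}
    (hy : y ∈ eigenMod cs N χ) : rho cs (cs.simple s) y ∈ eigenMod cs N ψ := by
  rw [mem_eigenMod] at hy ⊢
  intro n hn
  have := rho_mem_radical (cs := cs) (hy _ (conj_simple_mem (cs := cs) s hn)) (cs.simple s)
  rwa [map_sub, map_smul, ← rho_rho_simple, h n hn] at this

lemma eq_zero_of_smul_mem_radical {x : B → ℝ} (hx : x ∉ radical M) {c : ℝ}
    (h : c • x ∈ radical M) : c = 0 := by
  by_contra hc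
  exact hx (((radical M).smul_mem_iff hc).mp h)

/-- A vector that is an eigenvector modulo the radical for every element of `N` satisfies
`(n x, n' y) = χ(n) ψ(n) (x, y)`. -/
lemma form_eq_mul_of_eigenMod {x y : B → ℝ} {n : W} {a b : ℝ}
    (hx : rho cs n x - a • x ∈ radical M) (hy : rho cs n y - b • y ∈ radical M) :
    form M x y = a * b * form M x y := by
  have e1 := form_of_mem_radical_left hx (rho cs n y)
  have e2 := form_of_mem_radical_right hy x
  simp only [map_sub, map_smul, LinearMap.sub_apply, LinearMap.smul_apply, smul_eq_mul,
    form_rho] at e1 e2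
  linear_combination e1 + a * e2

lemma not_forall_sq_eq_one (cs : CoxeterSystem M W) [Infinite W] (hirr : IsIrreducible M)
    (hneg : ¬ IsPosSemidef M) (N : Subgroup W) [N.FiniteIndex] : ¬ ∀ n ∈ N, n ^ 2 = 1 := by
  intro h
  obtain ⟨s⟩ := hirr.nonempty
  obtain ⟨g, hgN, hg⟩ := exists_mem_skewers cs hirr hneg N s
  have := hg.pow_eq_zero (k := 2) (by rw [h g hgN, rho_one_apply])
  omega

/-- A finite index normal subgroup has no line of common eigenvectors modulo the radical. -/
lemma radical_of_eigenMod [Infinite W] (hirr : IsIrreducible M) (hneg : ¬ IsPosSemidef M)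
    {N : Subgroup W} [N.Normal] [N.FiniteIndex] {x : B → ℝ} {χ : W → ℝ}
    (hχ : x ∈ eigenMod cs N χ) : x ∈ radical M := by
  by_contra hx
  have hχ' := mem_eigenMod.mp hχ
  by_cases hsq : ∀ n ∈ N, χ n * χ n = 1
  · let L : Submodule ℝ (B → ℝ) :=
      ⨅ n ∈ N, (radical M).comap (rho cs (n ^ 2) - (1 : Module.End ℝ (B → ℝ)))
    have hL : ∀ y, y ∈ L ↔ ∀ n ∈ N, rho cs (n ^ 2) y - y ∈ radical M := fun y => by
      simp [L, Submodule.mem_iInf]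
    have hxL : x ∈ L := by
      rw [hL]
      intro n hn
      have h1 := rho_mem_radical (cs := cs) (hχ' n hn) n
      have h2 := (radical M).smul_mem (χ n) (hχ' n hn)
      have h3 := (radical M).add_mem h1 h2
      rw [map_sub, map_smul, smul_sub, smul_smul, hsq n hn, one_smul, sub_add_sub_cancel,
        ← rho_mul_apply, ← sq] at h3
      exact h3
    have htop : L = ⊤ := by
      refine eq_top_of_refl_stable hirr (fun s y hy => ?_) fun h => hx (h hxL)
      rw [← rho_simple cs, hL]
      intro n hn
      have := rho_mem_radical (cs := cs) ((hL y).mp hy _ (conj_simple_mem (cs := cs) s hn))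
        (cs.simple s)
      rw [map_sub] at this
      rw [rho_rho_simple]
      convert this using 5
      simp [sq, mul_assoc]
    refine not_forall_sq_eq_one cs hirr hneg N fun n hn => ?_
    refine eq_one_of_rho_sub_mem_radical (cs := cs) hirr hneg fun v => ?_
    exact (hL v).mp (htop ▸ Submodule.mem_top) n hn
  · push Not at hsq
    obtain ⟨m, hm, hm1⟩ := hsq
    have hxx : form M x x = 0 := by
      have := form_eq_mul_of_eigenMod (hχ' m hm) (hχ' m hm)
      have h2 : (χ m * χ m - 1) * form M x x = 0 := by linarith
      exact (mul_eq_zero.mp h2).resolve_left (sub_ne_zero.mpr hm1)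
    have hfix : ∀ s, form M x (sroot s) = 0 →
        ∀ n ∈ N, χ (cs.simple s * n * cs.simple s) = χ n := by
      intro s hs n hn
      have h1 : rho cs (cs.simple s) x = x := by simp [rho_simple, refl_apply, hs]
      have h2 := rho_mem_radical (cs := cs) (hχ' _ (conj_simple_mem (cs := cs) s hn)) (cs.simple s)
      rw [map_sub, map_smul, ← rho_rho_simple, h1] at h2
      have h3 := (radical M).sub_mem (hχ' n hn) h2
      rw [sub_sub_sub_cancel_left, ← sub_smul] at h3
      exact sub_eq_zero.mp (eq_zero_of_smul_mem_radical hx h3)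
    have hswap : ∀ s, form M x (sroot s) ≠ 0 →
        ∀ n ∈ N, χ (cs.simple s * n * cs.simple s) = (χ n)⁻¹ := by
      intro s hs n hn
      have h2 := rho_mem_radical (cs := cs) (hχ' _ (conj_simple_mem (cs := cs) s hn)) (cs.simple s)
      rw [map_sub, map_smul, ← rho_rho_simple] at h2
      have h3 := form_eq_mul_of_eigenMod (hχ' n hn) h2
      have h4 : form M x (rho cs (cs.simple s) x) ≠ 0 := by
        rw [rho_simple, refl_apply, map_sub, map_smul, hxx, zero_sub, smul_eq_mul, neg_ne_zero]
        exact mul_ne_zero (mul_ne_zero two_ne_zero hs) hs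
      exact eq_inv_of_mul_eq_one_right
        (mul_right_cancel₀ h4 (by rw [one_mul]; exact h3.symm))
    have hinv : ∀ s, (∀ n ∈ N, χ (cs.simple s * n * cs.simple s) = (χ n)⁻¹) →
        ∀ n ∈ N, (fun k => (χ k)⁻¹) (cs.simple s * n * cs.simple s) = χ n := by
      intro s hs n hn
      simp only [hs n hn, inv_inv]
    have htop : eigenMod cs N χ ⊔ eigenMod cs N (fun k => (χ k)⁻¹) = ⊤ := by
      refine eq_top_of_refl_stable hirr (fun s y hy => ?_)
        fun h => hx (h (Submodule.mem_sup_left hχ))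
      rw [← rho_simple cs]
      obtain ⟨a, ha, b, hb, rfl⟩ := Submodule.mem_sup.mp hy
      rw [map_add]
      by_cases hs : form M x (sroot s) = 0
      · refine Submodule.add_mem_sup (rho_simple_mem_eigenMod (hfix s hs) ha)
          (rho_simple_mem_eigenMod (fun n hn => ?_) hb)
        rw [hfix s hs n hn]
      · rw [add_comm]
        exact Submodule.add_mem_sup (rho_simple_mem_eigenMod (hinv s (hswap s hs)) hb)
          (rho_simple_mem_eigenMod (hswap s hs) ha)
    obtain ⟨t, ht⟩ : ∃ t, form M x (sroot t) ≠ 0 := by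
      by_contra! hcon
      apply hx
      rw [mem_radical]
      intro u
      rw [form_eq_sum]
      simp [hcon]
    have hline : ∀ y ∈ eigenMod cs N χ, ∃ c : ℝ, y - c • x ∈ radical M := by
      intro y hy
      refine ⟨form M y (sroot t) / form M x (sroot t), ?_⟩
      set z := y - (form M y (sroot t) / form M x (sroot t)) • x with hz
      have hzE : z ∈ eigenMod cs N χ := Submodule.sub_mem _ hy (Submodule.smul_mem _ _ hχ)
      have hz0 : form M z (sroot t) = 0 := by
        rw [hz, map_sub, map_smul, LinearMap.sub_apply, LinearMap.smul_apply, smul_eq_mul,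
          div_mul_cancel₀ _ ht, sub_self]
      have h1 : rho cs (cs.simple t) z = z := by simp [rho_simple, refl_apply, hz0]
      have h2 := rho_simple_mem_eigenMod (hswap t ht) hzE
      rw [h1] at h2
      have h3 := (radical M).sub_mem (mem_eigenMod.mp h2 m hm) (mem_eigenMod.mp hzE m hm)
      rw [sub_sub_sub_cancel_left, ← sub_smul] at h3
      by_contra hzR
      have h4 := sub_eq_zero.mp (eq_zero_of_smul_mem_radical hzR h3)
      by_cases h0 : χ m = 0
      · have := hχ' m hm
        rw [h0, zero_smul, sub_zero] at this
        apply hx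
        have := rho_mem_radical (cs := cs) this m⁻¹
        rwa [rho_inv_rho] at this
      · apply hm1
        nth_rw 1 [h4]
        exact inv_mul_cancel₀ h0
    refine not_forall_mem_span_pair hirr hneg x (rho cs (cs.simple t) x) fun u => ?_
    obtain ⟨a, ha, b, hb, rfl⟩ := Submodule.mem_sup.mp (htop ▸ Submodule.mem_top (x := u))
    obtain ⟨p, hp⟩ := hline a ha
    obtain ⟨q, hq⟩ := hline _ (rho_simple_mem_eigenMod (hinv t (hswap t ht)) hb)
    refine ⟨p, q, ?_⟩
    have h1 := rho_mem_radical (cs := cs) hq (cs.simple t)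
    rw [map_sub, map_smul, ← rho_mul_apply, cs.simple_mul_simple_self, rho_one_apply] at h1
    have h2 := (radical M).add_mem hp h1
    convert h2 using 1
    abel

/-- A minimal submodule stable under a normal finite index subgroup is everything. -/
lemma eq_top_of_minimal_stable [Infinite W] (hirr : IsIrreducible M) (hneg : ¬ IsPosSemidef M)
    {N : Subgroup W} [N.Normal] [N.FiniteIndex] {Y : Submodule ℝ (B → ℝ)}
    (hR : radical M < Y) (hY : ∀ n ∈ N, ∀ y ∈ Y, rho cs n y ∈ Y)
    (hmin : ∀ Z : Submodule ℝ (B → ℝ), radical M ≤ Z → Z ≤ Y →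
      (∀ n ∈ N, ∀ z ∈ Z, rho cs n z ∈ Z) → Z ≤ radical M ∨ Y ≤ Z) : Y = ⊤ := by
  by_contra hne
  obtain ⟨t, ht⟩ : ∃ t, ¬ ∀ y ∈ Y, refl M (sroot t) y ∈ Y := by
    by_contra! hcon
    exact hne (eq_top_of_refl_stable hirr hcon (not_le_of_gt hR))
  let Z : Submodule ℝ (B → ℝ) := Y ⊓ Y.comap (rho cs (cs.simple t))
  have hZmem : ∀ z, z ∈ Z ↔ z ∈ Y ∧ rho cs (cs.simple t) z ∈ Y := fun z => Iff.rfl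
  have hZ : Z ≤ radical M := by
    refine (hmin Z (fun z hz => ⟨hR.le hz, hR.le (rho_mem_radical hz _)⟩) inf_le_left
      fun n hn z hz => ⟨hY n hn z hz.1, ?_⟩).resolve_right fun h => ht fun y hy => ?_
    · have h1 := hY _ (conj_simple_mem (cs := cs) t hn) _ hz.2
      rw [rho_mul_apply, ← rho_mul_apply _ (cs.simple t) (cs.simple t), cs.simple_mul_simple_self,
        rho_one_apply, rho_mul_apply] at h1
      exact h1
    · rw [← rho_simple cs]
      exact (h hy).2
  obtain ⟨x, hxY, hxR⟩ := SetLike.exists_of_lt hR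
  have hperp : ∀ y ∈ Y, form M y (sroot t) = 0 → y ∈ radical M := by
    intro y hy h0
    refine hZ ⟨hy, ?_⟩
    have : rho cs (cs.simple t) y = y := by simp [rho_simple, refl_apply, h0]
    change rho cs (cs.simple t) y ∈ Y
    rwa [this]
  have hx0 : form M x (sroot t) ≠ 0 := fun h => hxR (hperp x hxY h)
  refine hxR (radical_of_eigenMod (cs := cs) (N := N) hirr hneg
    (χ := fun n => form M (rho cs n x) (sroot t) / form M x (sroot t)) ?_)
  rw [mem_eigenMod]
  intro n hn
  refine hperp _ (Y.sub_mem (hY n hn x hxY) (Y.smul_mem _ hxY)) ?_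
  rw [map_sub, map_smul, LinearMap.sub_apply, LinearMap.smul_apply, smul_eq_mul,
    div_mul_cancel₀ _ hx0, sub_self]

/-- Finite index subgroups act irreducibly modulo the radical. -/
theorem sup_radical_eq_top_of_stable [Infinite W] (hirr : IsIrreducible M)
    (hneg : ¬ IsPosSemidef M) {K : Subgroup W} [K.FiniteIndex] {X : Submodule ℝ (B → ℝ)}
    (hX : ∀ k ∈ K, ∀ x ∈ X, rho cs k x ∈ X) (hR : ¬ X ≤ radical M) : X ⊔ radical M = ⊤ := by
  let P : Set (Submodule ℝ (B → ℝ)) := {Y | radical M < Y ∧ Y ≤ X ⊔ radical M ∧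
    ∀ n ∈ K.normalCore, ∀ y ∈ Y, rho cs n y ∈ Y}
  have hP : X ⊔ radical M ∈ P := by
    refine ⟨right_lt_sup.mpr hR, le_rfl, fun n hn y hy => ?_⟩
    obtain ⟨a, ha, b, hb, rfl⟩ := Submodule.mem_sup.mp hy
    rw [map_add]
    exact Submodule.add_mem_sup (hX n (K.normalCore_le hn) a ha) (rho_mem_radical hb n)
  obtain ⟨Y, hYP, hYmin⟩ := wellFounded_lt.has_min P ⟨_, hP⟩
  have hYtop : Y = ⊤ := by
    refine eq_top_of_minimal_stable (cs := cs) (N := K.normalCore) hirr hneg hYP.1 hYP.2.2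
      fun Z hRZ hZY hZ => ?_
    by_contra! hcon
    refine hYmin Z ⟨lt_of_le_not_ge hRZ hcon.1, hZY.trans hYP.2.1, hZ⟩ ?_
    exact lt_of_le_not_ge hZY hcon.2
  exact top_le_iff.mp (hYtop ▸ hYP.2.1)

/-- The virtual center is trivial. -/
theorem eq_one_of_commute_finiteIndex (cs : CoxeterSystem M W) [Infinite W]
    (hirr : IsIrreducible M) (hneg : ¬ IsPosSemidef M) {K : Subgroup W} [K.FiniteIndex] {z : W}
    (hz : ∀ k ∈ K, Commute k z) : z = 1 := by
  have hcentral : ∀ s, Commute (cs.simple s) z := by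
    intro s
    set c := cs.simple s * (z * cs.simple s * z⁻¹) with hc
    have hcv : ∀ v, ∃ p q : ℝ, rho cs c v - v = p • sroot s + q • rho cs z (sroot s) := by
      intro v
      refine ⟨-(2 * form M (refl M (rho cs z (sroot s)) v) (sroot s)),
        -(2 * form M v (rho cs z (sroot s))), ?_⟩
      rw [hc, rho_mul_apply, rho_conj_simple, rho_simple, refl_apply M (sroot s)]
      nth_rw 1 [refl_apply]
      module
    have hcomm : ∀ n ∈ K.normalCore, Commute n c := by
      intro n hn
      have h1 := hz n (K.normalCore_le hn)
      have h2 := hz _ (K.normalCore_le (conj_simple_mem (cs := cs) s hn))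
      have h3 : Commute n (cs.simple s * z * cs.simple s) := by
        have h4 := congrArg (fun w => cs.simple s * w * cs.simple s) h2.eq
        simp only [mul_assoc, cs.simple_mul_simple_cancel_left] at h4
        rw [Commute, SemiconjBy]
        simpa only [mul_assoc, cs.simple_mul_simple_self, mul_one] using h4
      have e : c = cs.simple s * z * cs.simple s * z⁻¹ := by
        rw [hc]
        group
      rw [e]
      exact h3.mul_right h1.inv_right
    have hle : LinearMap.range (rho cs c - 1) ≤ radical M := by
      by_contra hnot
      have htop := sup_radical_eq_top_of_stable (cs := cs) (K := K.normalCore) hirr hneg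
        (X := LinearMap.range (rho cs c - 1)) ?_ hnot
      · refine not_forall_mem_span_pair hirr hneg (sroot s) (rho cs z (sroot s)) fun u => ?_
        obtain ⟨a, ⟨v, rfl⟩, b, hb, hab⟩ :=
          Submodule.mem_sup.mp (htop ▸ Submodule.mem_top (x := u))
        obtain ⟨p, q, hpq⟩ := hcv v
        refine ⟨p, q, ?_⟩
        rw [← hab, ← hpq]
        simpa using hb
      · rintro n hn _ ⟨v, rfl⟩
        refine ⟨rho cs n v, ?_⟩
        simp only [LinearMap.sub_apply, Module.End.one_apply, map_sub, ← rho_mul_apply,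
          (hcomm n hn).eq]
    have hc1 : c = 1 := by
      refine eq_one_of_rho_sub_mem_radical (cs := cs) hirr hneg fun v => hle ⟨v, ?_⟩
      simp
    have h1 := eq_inv_of_mul_eq_one_right hc1
    rw [cs.inv_simple, mul_inv_eq_iff_eq_mul] at h1
    exact h1.symm
  obtain ⟨s⟩ := hirr.nonempty
  set e := form M (rho cs z (sroot s)) (sroot s) with he
  have hze : rho cs z (sroot s) = e • sroot s := by
    have h1 : rho cs (cs.simple s) (rho cs z (sroot s)) = -rho cs z (sroot s) := by
      rw [← rho_mul_apply, (hcentral s).eq, rho_mul_apply, rho_simple_sroot_self, map_neg]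
    rw [rho_simple, refl_apply, ← he] at h1
    have h2 : (2 : ℝ) • rho cs z (sroot s) = (2 : ℝ) • (e • sroot s) := by
      rw [smul_smul, two_smul]
      rw [sub_eq_iff_eq_add] at h1
      nth_rw 1 [h1]
      abel
    exact smul_right_injective _ (two_ne_zero' ℝ) h2
  have he1 : e * e = 1 := by
    have h1 := form_rho cs z (sroot s) (sroot s)
    rw [hze, map_smul, map_smul, LinearMap.smul_apply, smul_eq_mul, smul_eq_mul,
      form_sroot_self, mul_one] at h1
    exact h1
  have htop : LinearMap.ker (rho cs z - e • (1 : Module.End ℝ (B → ℝ))) = ⊤ := by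
    refine eq_top_of_refl_stable hirr (fun r x hx => ?_)
      fun h => sroot_notMem_radical (M := M) s (h ?_)
    · simp only [LinearMap.mem_ker, LinearMap.sub_apply, LinearMap.smul_apply,
        Module.End.one_apply, sub_eq_zero] at hx ⊢
      rw [← rho_simple cs, rho_comm_apply (hcentral r), hx, map_smul]
    · simp [hze]
  have : Nonempty B := ⟨s⟩
  obtain ⟨v, hv⟩ := exists_isNegVector hirr hneg
  refine hv.eq_one_of_form_rho_eq (cs := cs) ?_
  have h1 : rho cs z v = e • v := by
    have := htop ▸ Submodule.mem_top (x := v)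
    simpa only [LinearMap.mem_ker, LinearMap.sub_apply, LinearMap.smul_apply,
        Module.End.one_apply, sub_eq_zero] using this
  rw [h1, map_smul, LinearMap.smul_apply, smul_eq_mul]
  have h2 := hv.form_self_neg
  have h3 : e ≤ 1 := by nlinarith
  nlinarith

end Irreducibility

section CommutingSubgroups

open scoped commutatorElement

lemma range_noncommCoprod_subtype {G : Type*} [Group G] {A C : Subgroup G}
    (hAC : ∀ a ∈ A, ∀ c ∈ C, Commute a c) :
    (MonoidHom.noncommCoprod A.subtype C.subtype fun a c => hAC a a.2 c c.2).range = A ⊔ C := by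
  exact (MonoidHom.noncommCoprod_range (f := A.subtype) (g := C.subtype) _).trans
    (by rw [A.range_subtype, C.range_subtype])

lemma exists_mul_eq_of_mem_sup {G : Type*} [Group G] {A C : Subgroup G}
    (hAC : ∀ a ∈ A, ∀ c ∈ C, Commute a c) {g : G} (hg : g ∈ A ⊔ C) :
    ∃ a ∈ A, ∃ c ∈ C, a * c = g := by
  rw [← range_noncommCoprod_subtype hAC] at hg
  obtain ⟨⟨a, c⟩, rfl⟩ := hg
  exact ⟨a, a.2, c, c.2, rfl⟩

lemma commutatorElement_mem {G : Type*} [Group G] {A : Subgroup G} {x y : G} (hx : x ∈ A)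
    (hy : y ∈ A) : ⁅x, y⁆ ∈ A :=
  A.mul_mem (A.mul_mem (A.mul_mem hx hy) (A.inv_mem hx)) (A.inv_mem hy)

lemma finiteIndex_sup_of_commute {G : Type*} [Group G] {A C A₁ C₁ : Subgroup G}
    (hAC : ∀ a ∈ A, ∀ c ∈ C, Commute a c) [(A ⊔ C).FiniteIndex]
    (hA : A₁.relIndex A ≠ 0) (hC : C₁.relIndex C ≠ 0) : (A₁ ⊔ C₁).FiniteIndex := by
  let φ : A × C →* G := MonoidHom.noncommCoprod A.subtype C.subtype
    fun a c => hAC a a.2 c c.2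
  have hφ : φ.range = A ⊔ C := range_noncommCoprod_subtype hAC
  have h1 : ((A₁.subgroupOf A).prod (C₁.subgroupOf C)).FiniteIndex :=
    ⟨by rw [Subgroup.index_prod]; exact mul_ne_zero hA hC⟩
  have h2 : (((A₁.subgroupOf A).prod (C₁.subgroupOf C)).map φ).FiniteIndex := by
    refine ⟨?_⟩
    rw [Subgroup.index_map, hφ]
    exact mul_ne_zero (Subgroup.finiteIndex_of_le le_sup_left).index_ne_zero
      Subgroup.FiniteIndex.index_ne_zero
  refine Subgroup.finiteIndex_of_le (H := ((A₁.subgroupOf A).prod (C₁.subgroupOf C)).map φ) ?_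
  rintro _ ⟨⟨a, c⟩, ⟨ha, hc⟩, rfl⟩
  exact Subgroup.mul_mem_sup ha hc

lemma finiteIndex_of_forall_eq {G X : Type*} [Group G] {H : Subgroup G} {F : Set X}
    (hF : F.Finite) (f : G → X) (hf : ∀ x, f x ∈ F) (h : ∀ x y, f x = f y → x⁻¹ * y ∈ H) :
    H.FiniteIndex := by
  have := hF.to_subtype
  have : Finite (G ⧸ H) := by
    refine Finite.of_injective (β := F) (fun q => ⟨f q.out, hf _⟩) fun p q hpq => ?_
    rw [← p.out_eq', ← q.out_eq', QuotientGroup.eq]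
    exact h _ _ (congrArg Subtype.val hpq)
  exact Subgroup.finiteIndex_of_finite_quotient

variable {B W : Type*} [Fintype B] [Group W] {M : CoxeterMatrix B} {cs : CoxeterSystem M W}

lemma rho_mul_eq_zpow {g x y : W} {γ : B → ℝ} {n m : ℤ} (hx : Commute x g)
    (ex : rho cs x γ = rho cs (g ^ n) γ) (ey : rho cs y γ = rho cs (g ^ m) γ) :
    rho cs (x * y) γ = rho cs (g ^ (n + m)) γ := by
  rw [rho_mul_apply, ey, ← rho_comm_apply (hx.zpow_right m), ex, ← rho_mul_apply, ← zpow_add,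
    add_comm]

lemma rho_inv_eq_zpow {g x : W} {γ : B → ℝ} {n : ℤ} (hx : Commute x g)
    (ex : rho cs x γ = rho cs (g ^ n) γ) : rho cs x⁻¹ γ = rho cs (g ^ (-n)) γ := by
  have h : γ = rho cs (g ^ (-n)) (rho cs x γ) := by
    rw [ex, ← rho_mul_apply, ← zpow_add, neg_add_cancel, zpow_zero, rho_one_apply]
  conv_lhs => rw [h, ← rho_comm_apply (hx.inv_left.zpow_right (-n)), rho_inv_rho]

/-- The elements of `C` acting on the vector `γ` like a power of `g`. -/
noncomputable def powStabilizer (cs : CoxeterSystem M W) (g : W) (γ : B → ℝ) (C : Subgroup W)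
    (hC : ∀ c ∈ C, Commute c g) : Subgroup C where
  carrier := {c | ∃ n : ℤ, rho cs c γ = rho cs (g ^ n) γ}
  one_mem' := ⟨0, by simp⟩
  mul_mem' := by
    rintro x y ⟨n, hn⟩ ⟨m, hm⟩
    exact ⟨n + m, rho_mul_eq_zpow (hC x x.2) hn hm⟩
  inv_mem' := by
    rintro x ⟨n, hn⟩
    exact ⟨-n, rho_inv_eq_zpow (hC x x.2) hn⟩

lemma finiteIndex_powStabilizer {g : W} {γ : B → ℝ} {C : Subgroup W}
    (hC : ∀ c ∈ C, Commute c g) (hg : Skewers cs g γ) :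
    (powStabilizer cs g γ C hC).FiniteIndex := by
  obtain ⟨F, hF, h⟩ := exists_finite_skewers cs g
  choose n hn using fun c : C => h _ (hg.rho_of_commute (hC c c.2))
  refine finiteIndex_of_forall_eq hF _ hn fun x y hxy => ⟨n x - n y, ?_⟩
  have h1 : rho cs y γ = rho cs (g ^ (n x - n y)) (rho cs x γ) := by
    rw [sub_eq_neg_add, zpow_add, rho_mul_apply, hxy, ← rho_mul_apply, ← zpow_add, neg_add_cancel,
      zpow_zero, rho_one_apply]
  rw [Subgroup.coe_mul, rho_mul_apply, h1, rho_comm_apply ((hC x x.2).zpow_right _)]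
  exact rho_inv_rho cs _ _

lemma rho_commutator_eq_self {g x y : W} {γ : B → ℝ} {n m : ℤ} (hx : Commute x g)
    (hy : Commute y g) (ex : rho cs x γ = rho cs (g ^ n) γ)
    (ey : rho cs y γ = rho cs (g ^ m) γ) : rho cs ⁅x, y⁆ γ = γ := by
  rw [commutatorElement_def, rho_mul_eq_zpow ((hx.mul_left hy).mul_left hx.inv_left)
    (rho_mul_eq_zpow (hx.mul_left hy) (rho_mul_eq_zpow hx ex ey) (rho_inv_eq_zpow hx ex))
    (rho_inv_eq_zpow hy ey), add_neg_cancel_comm, add_neg_cancel, zpow_zero, rho_one_apply]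

/-- If a product of commuting elements skewers `γ`, so does a power of one of the factors. -/
lemma Skewers.pow_left_or_right {a c : W} {γ : B → ℝ} (h : Skewers cs (a * c) γ)
    (hac : Commute a c) : ∃ k : ℕ, Skewers cs (a ^ k) γ ∨ Skewers cs (c ^ k) γ := by
  have ha : Commute a (a * c) := (Commute.refl a).mul_right hac
  have hc : Commute c (a * c) := hac.symm.mul_right (Commute.refl c)
  have hcent : ∀ x ∈ Subgroup.centralizer {a * c}, Commute x (a * c) := fun x hx =>
    (Subgroup.mem_centralizer_singleton_iff.mp hx)
  obtain ⟨k, hk, -, n, hn⟩ := Subgroup.exists_pow_mem_of_index_ne_zero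
    (finiteIndex_powStabilizer hcent h).index_ne_zero
    ⟨a, Subgroup.mem_centralizer_singleton_iff.mpr ha⟩
  rw [Subgroup.coe_pow] at hn
  refine ⟨k, ?_⟩
  by_cases h0 : n = 0
  · refine .inr (h.of_zpow_eq (hc.pow_left k) (m := -n + k) (by omega) ?_)
    have e : c ^ k = (a ^ k)⁻¹ * (a * c) ^ k := by rw [hac.mul_pow, inv_mul_cancel_left]
    rw [e]
    exact rho_mul_eq_zpow (ha.pow_left k).inv_left (rho_inv_eq_zpow (ha.pow_left k) hn)
      (by rw [zpow_natCast])
  · exact .inl (h.of_zpow_eq (ha.pow_left k) h0 hn)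

lemma exists_commutator_fixing {C : Subgroup W} {S : Set B}
    (hS : ∀ s ∈ S, ∃ g, (∀ c ∈ C, Commute c g) ∧ Skewers cs g (sroot s)) :
    ∃ C₁ ≤ C, C₁.relIndex C ≠ 0 ∧
      ∀ c ∈ C₁, ∀ c' ∈ C₁, ∀ s ∈ S, rho cs ⁅c, c'⁆ (sroot s) = sroot s := by
  choose g hg hsk using fun s : S => hS s s.2
  let D : Subgroup C := ⨅ s : S, powStabilizer cs (g s) (sroot s) C (hg s)
  have hD : D.FiniteIndex :=
    Subgroup.finiteIndex_iInf fun s => finiteIndex_powStabilizer (hg s) (hsk s)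
  refine ⟨D.map C.subtype, Subgroup.map_subtype_le D, ?_, ?_⟩
  · rw [Subgroup.relIndex, Subgroup.subgroupOf, Subgroup.comap_map_eq_self_of_injective
      C.subtype_injective]
    exact hD.index_ne_zero
  · rintro _ ⟨x, hx, rfl⟩ _ ⟨y, hy, rfl⟩ s hs
    obtain ⟨n, hn⟩ := Subgroup.mem_iInf.mp hx ⟨s, hs⟩
    obtain ⟨m, hm⟩ := Subgroup.mem_iInf.mp hy ⟨s, hs⟩
    exact rho_commutator_eq_self (hg ⟨s, hs⟩ x x.2) (hg ⟨s, hs⟩ y y.2) hn hm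

/-- The span of the displacements of all vectors under commutators of elements of `A`. -/
noncomputable def displacement (cs : CoxeterSystem M W) (A : Subgroup W) :
    Submodule ℝ (B → ℝ) :=
  Submodule.span ℝ {x | ∃ a ∈ A, ∃ a' ∈ A, ∃ u, x = rho cs ⁅a, a'⁆ u - u}

lemma rho_mem_displacement {A : Subgroup W} {k : W} (hk : ∀ a ∈ A, k * a * k⁻¹ ∈ A)
    {x : B → ℝ} (hx : x ∈ displacement cs A) : rho cs k x ∈ displacement cs A := by
  suffices displacement cs A ≤ (displacement cs A).comap (rho cs k) from this hx
  refine Submodule.span_le.mpr ?_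
  rintro _ ⟨a, ha, a', ha', u, rfl⟩
  refine Submodule.subset_span ⟨_, hk a ha, _, hk a' ha', rho cs k u, ?_⟩
  rw [map_sub, ← rho_mul_apply, ← rho_mul_apply, ← conjugate_commutatorElement,
    inv_mul_cancel_right]

lemma form_displacement_eq_zero {d e : W} (hde : Commute d e)
    (h : ∀ s, rho cs d (sroot s) = sroot s ∨ rho cs e (sroot s) = sroot s) (u v : B → ℝ) :
    form M (rho cs d u - u) (rho cs e v - v) = 0 := by
  have h1 : form M (rho cs d u - u) (rho cs e v - v) =
      form M (rho cs d⁻¹ (rho cs e v - v) - (rho cs e v - v)) u := by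
    rw [LinearMap.map_sub₂, LinearMap.map_sub₂, form_rho_left, form_symm M u, form_symm M u]
  rw [h1, form_eq_sum]
  refine Finset.sum_eq_zero fun s _ => ?_
  rw [mul_eq_zero]
  right
  rcases h s with hs | hs
  · rw [LinearMap.map_sub₂, form_rho_left, inv_inv, hs, sub_self]
  · have h2 : rho cs d⁻¹ (rho cs e v - v) - (rho cs e v - v) =
        rho cs e (rho cs d⁻¹ v - v) - (rho cs d⁻¹ v - v) := by
      rw [map_sub, map_sub, rho_comm_apply hde.symm.inv_right]
      abel
    rw [h2, LinearMap.map_sub₂, form_rho_left,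
      rho_inv_eq_self hs, sub_self]

lemma eq_bot_of_displacement_le_radical (cs : CoxeterSystem M W) [Infinite W]
    (hirr : IsIrreducible M) (hneg : ¬ IsPosSemidef M) {A C A₁ C₁ : Subgroup W}
    (hAC : ∀ a ∈ A, ∀ c ∈ C, Commute a c) [(A ⊔ C).FiniteIndex] (hA₁ : A₁ ≤ A) (hC₁ : C₁ ≤ C)
    (hA : A₁.relIndex A ≠ 0) (hC : C₁.relIndex C ≠ 0)
    (h : displacement cs A₁ ≤ radical M) : A = ⊥ := by
  have hfin := finiteIndex_sup_of_commute hAC hA hC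
  have hcomm : ∀ a ∈ A₁, ∀ a' ∈ A₁, Commute a a' := fun a ha a' ha' =>
    commutatorElement_eq_one_iff_commute.mp (eq_one_of_rho_sub_mem_radical (cs := cs) hirr hneg
      fun v => h (Submodule.subset_span ⟨a, ha, a', ha', v, rfl⟩))
  have hbot : A₁ = ⊥ := by
    refine (Subgroup.eq_bot_iff_forall _).mpr fun a ha => ?_
    refine eq_one_of_commute_finiteIndex cs hirr hneg (K := A₁ ⊔ C₁) fun k hk => ?_
    have hle : A₁ ⊔ C₁ ≤ Subgroup.centralizer {a} := sup_le
      (fun x hx => Subgroup.mem_centralizer_singleton_iff.mpr (hcomm x hx a ha))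
      fun x hx => Subgroup.mem_centralizer_singleton_iff.mpr (hAC a (hA₁ ha) x (hC₁ hx)).symm
    exact Subgroup.mem_centralizer_singleton_iff.mp (hle hk)
  have hCfin : C.FiniteIndex := by
    have := finiteIndex_sup_of_commute (C₁ := C) hAC hA (by simp)
    rwa [hbot, bot_sup_eq] at this
  exact (Subgroup.eq_bot_iff_forall _).mpr fun a ha =>
    eq_one_of_commute_finiteIndex cs hirr hneg fun c hc => (hAC a ha c hc).symm

/-- Irreducible infinite non-affine Coxeter groups are not virtually decomposable. -/
theorem eq_bot_or_eq_bot_of_commute (cs : CoxeterSystem M W) [Infinite W]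
    (hirr : IsIrreducible M) (hneg : ¬ IsPosSemidef M) {A C : Subgroup W}
    (hAC : ∀ a ∈ A, ∀ c ∈ C, Commute a c) [(A ⊔ C).FiniteIndex] : A = ⊥ ∨ C = ⊥ := by
  obtain ⟨C₁, hC₁, hC, hCfix⟩ := exists_commutator_fixing (cs := cs) (C := C)
    (S := {s | ∃ a ∈ A, Skewers cs a (sroot s)})
    fun s ⟨a, ha, hs⟩ => ⟨a, fun c hc => (hAC a ha c hc).symm, hs⟩
  obtain ⟨A₁, hA₁, hA, hAfix⟩ := exists_commutator_fixing (cs := cs) (C := A)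
    (S := {s | ∃ c ∈ C, Skewers cs c (sroot s)})
    fun s ⟨c, hc, hs⟩ => ⟨c, fun a ha => hAC a ha c hc, hs⟩
  have hcover : ∀ s, (∃ a ∈ A, Skewers cs a (sroot s)) ∨ ∃ c ∈ C, Skewers cs c (sroot s) := by
    intro s
    obtain ⟨g, hg, hs⟩ := exists_mem_skewers cs hirr hneg (A ⊔ C) s
    obtain ⟨a, ha, c, hc, rfl⟩ := exists_mul_eq_of_mem_sup hAC hg
    obtain ⟨k, hk | hk⟩ := hs.pow_left_or_right (hAC a ha c hc)
    · exact .inl ⟨_, A.pow_mem ha k, hk⟩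
    · exact .inr ⟨_, C.pow_mem hc k, hk⟩
  have hfin := finiteIndex_sup_of_commute hAC hA hC
  have horth : ∀ x ∈ displacement cs A₁, ∀ y ∈ displacement cs C₁, form M x y = 0 := by
    intro x hx y hy
    induction hx using Submodule.span_induction with
    | zero => simp
    | add x x' _ _ h h' => rw [LinearMap.map_add₂, h, h', add_zero]
    | smul r x _ h => rw [LinearMap.map_smul₂, h, smul_zero]
    | mem x hx =>
      obtain ⟨a, ha, a', ha', u, rfl⟩ := hx
      induction hy using Submodule.span_induction with
      | zero => simp
      | add y y' _ _ h h' => rw [map_add, h, h', add_zero]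
      | smul r y _ h => rw [map_smul, h, smul_zero]
      | mem y hy =>
        obtain ⟨c, hc, c', hc', v, rfl⟩ := hy
        exact form_displacement_eq_zero (hAC _ (commutatorElement_mem (hA₁ ha) (hA₁ ha')) _
          (commutatorElement_mem (hC₁ hc) (hC₁ hc')))
          (fun s => (hcover s).symm.imp (hAfix a ha a' ha' s) (hCfix c hc c' hc' s)) u v
  have hstable : ∀ k ∈ A₁ ⊔ C₁, ∀ x ∈ displacement cs A₁, rho cs k x ∈ displacement cs A₁ := by
    intro k hk x hx
    obtain ⟨b, hb, c, hc, rfl⟩ :=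
      exists_mul_eq_of_mem_sup (fun a ha c hc => hAC a (hA₁ ha) c (hC₁ hc)) hk
    refine rho_mem_displacement (fun a ha => ?_) hx
    rw [mul_inv_rev, mul_assoc b c a, ← (hAC a (hA₁ ha) c (hC₁ hc)).eq, ← mul_assoc b a c,
      ← mul_assoc, mul_inv_cancel_right]
    exact A₁.mul_mem (A₁.mul_mem hb ha) (A₁.inv_mem hb)
  by_cases h : displacement cs A₁ ≤ radical M
  · exact .inl (eq_bot_of_displacement_le_radical cs hirr hneg hAC hA₁ hC₁ hA hC h)
  · right
    have htop := sup_radical_eq_top_of_stable (cs := cs) (K := A₁ ⊔ C₁) hirr hneg hstable h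
    have : (C ⊔ A).FiniteIndex := by rwa [sup_comm]
    refine eq_bot_of_displacement_le_radical cs hirr hneg
      (fun c hc a ha => (hAC a ha c hc).symm) hC₁ hA₁ hC hA fun y hy => ?_
    rw [mem_radical]
    intro u
    obtain ⟨x, hx, r, hr, rfl⟩ := Submodule.mem_sup.mp (htop ▸ Submodule.mem_top (x := u))
    rw [form_symm, map_add, LinearMap.add_apply, horth x hx y hy, mem_radical.mp hr, add_zero]

end CommutingSubgroups

lemma finiteIndex_map_sup_map {G G' : Type*} [Group G] [Group G'] {f : G →* G'}
    (hf : Function.Surjective f) {H H₁ H₂ : Subgroup G} (hH : H.FiniteIndex)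
    (h : ∀ x ∈ H, ∃ a ∈ H₁, ∃ b ∈ H₂, x = a * b) : (H₁.map f ⊔ H₂.map f).FiniteIndex := by
  have h1 : (H.map f).FiniteIndex :=
    ⟨ne_zero_of_dvd_ne_zero hH.index_ne_zero (H.index_map_dvd hf)⟩
  refine Subgroup.finiteIndex_of_le (H := H.map f) ?_
  rw [← Subgroup.map_sup]
  refine Subgroup.map_mono fun x hx => ?_
  obtain ⟨a, ha, b, hb, rfl⟩ := h x hx
  exact Subgroup.mul_mem_sup ha hb

lemma commute_of_mem_map {G G' : Type*} [Group G] [Group G'] {H₁ H₂ : Subgroup G}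
    (h : ∀ a ∈ H₁, ∀ b ∈ H₂, Commute a b) (f : G →* G') :
    ∀ a ∈ H₁.map f, ∀ b ∈ H₂.map f, Commute a b := by
  rintro _ ⟨a, ha, rfl⟩ _ ⟨b, hb, rfl⟩
  exact (h a ha b hb).map f

/-- Let `W = W₁ × W₂` with `W₁, W₂` irreducible, infinite,
non-affine Coxeter groups, and let `H` be a finite index subgroup of `W` which is an
internal direct product `H = H₁ × H₂` of two nontrivial subgroups (`H₁, H₂` normal
in `H`, `H₁ ∩ H₂ = 1`, `H₁ H₂ = H`). Then, after possibly swapping indices,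
`H₁ ⊆ W₁ × {1}` and `H₂ ⊆ {1} × W₂`. -/
theorem factors_of_decomposition_lie_in_factors
    {B₁ B₂ W₁ W₂ : Type*} [Fintype B₁] [Fintype B₂] [Group W₁] [Group W₂]
    {M₁ : CoxeterMatrix B₁} {M₂ : CoxeterMatrix B₂}
    (cs₁ : CoxeterSystem M₁ W₁) (cs₂ : CoxeterSystem M₂ W₂)
    (hirr₁ : IsIrreducible M₁) (hirr₂ : IsIrreducible M₂)
    (hinf₁ : Infinite W₁) (hinf₂ : Infinite W₂)
    (hnonaff₁ : ¬ IsPosDef M₁ ∧ ¬ IsPosSemidef M₁)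
    (hnonaff₂ : ¬ IsPosDef M₂ ∧ ¬ IsPosSemidef M₂)
    (H H₁ H₂ : Subgroup (W₁ × W₂)) (hH : H.FiniteIndex)
    (h₁H : H₁ ≤ H) (h₂H : H₂ ≤ H)
    (h₁ne : H₁ ≠ ⊥) (h₂ne : H₂ ≠ ⊥)
    (h₁n : ∀ h ∈ H, ∀ a ∈ H₁, h * a * h⁻¹ ∈ H₁)
    (h₂n : ∀ h ∈ H, ∀ b ∈ H₂, h * b * h⁻¹ ∈ H₂)
    (hmeet : H₁ ⊓ H₂ = ⊥)
    (hprod : ∀ h ∈ H, ∃ a ∈ H₁, ∃ b ∈ H₂, h = a * b) :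
    (H₁ ≤ (⊤ : Subgroup W₁).prod (⊥ : Subgroup W₂) ∧
      H₂ ≤ (⊥ : Subgroup W₁).prod (⊤ : Subgroup W₂)) ∨
    (H₂ ≤ (⊤ : Subgroup W₁).prod (⊥ : Subgroup W₂) ∧
      H₁ ≤ (⊥ : Subgroup W₁).prod (⊤ : Subgroup W₂)) := by
  have hcomm : ∀ a ∈ H₁, ∀ b ∈ H₂, Commute a b := by
    intro a ha b hb
    have h1 : a * b * a⁻¹ * b⁻¹ ∈ H₁ ⊓ H₂ := by
      refine ⟨?_, H₂.mul_mem (h₂n a (h₁H ha) b hb) (H₂.inv_mem hb)⟩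
      rw [mul_assoc, mul_assoc, ← mul_assoc b]
      exact H₁.mul_mem ha (h₁n b (h₂H hb) a⁻¹ (H₁.inv_mem ha))
    rw [hmeet, Subgroup.mem_bot, mul_inv_eq_one, mul_inv_eq_iff_eq_mul] at h1
    exact h1
  have := finiteIndex_map_sup_map (f := MonoidHom.fst W₁ W₂) Prod.fst_surjective hH hprod
  have := finiteIndex_map_sup_map (f := MonoidHom.snd W₁ W₂) Prod.snd_surjective hH hprod
  have hle₁ : ∀ {L : Subgroup (W₁ × W₂)}, L.map (MonoidHom.snd W₁ W₂) = ⊥ →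
      L ≤ (⊤ : Subgroup W₁).prod (⊥ : Subgroup W₂) := fun hL x hx =>
    ⟨Subgroup.mem_top _, hL ▸ Subgroup.mem_map_of_mem (MonoidHom.snd W₁ W₂) hx⟩
  have hle₂ : ∀ {L : Subgroup (W₁ × W₂)}, L.map (MonoidHom.fst W₁ W₂) = ⊥ →
      L ≤ (⊥ : Subgroup W₁).prod (⊤ : Subgroup W₂) := fun hL x hx =>
    ⟨hL ▸ Subgroup.mem_map_of_mem (MonoidHom.fst W₁ W₂) hx, Subgroup.mem_top _⟩
  have hbot : ∀ {L : Subgroup (W₁ × W₂)}, L.map (MonoidHom.fst W₁ W₂) = ⊥ →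
      L.map (MonoidHom.snd W₁ W₂) = ⊥ → L = ⊥ := fun h1 h2 =>
    (Subgroup.eq_bot_iff_forall _).mpr fun x hx => Prod.ext (hle₂ h1 hx).1 (hle₁ h2 hx).2
  have h1 := eq_bot_or_eq_bot_of_commute cs₁ hirr₁ hnonaff₁.2
    (commute_of_mem_map hcomm (MonoidHom.fst W₁ W₂))
  have h2 := eq_bot_or_eq_bot_of_commute cs₂ hirr₂ hnonaff₂.2
    (commute_of_mem_map hcomm (MonoidHom.snd W₁ W₂))
  rcases h1 with h1 | h1 <;> rcases h2 with h2 | h2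
  · exact absurd (hbot h1 h2) h₁ne
  · exact .inr ⟨hle₁ h2, hle₂ h1⟩
  · exact .inl ⟨hle₁ h2, hle₂ h1⟩
  · exact absurd (hbot h1 h2) h₂ne

end CoxeterPaper
end
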